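/- Let q be an odd prime power with q ≥ 5. The group algebra ℂ[PSL₂(𝔽_q)] is of Knutson type (every irreducible complex character of PSL₂(𝔽_q) is regular invertible) if and only if q = 2^m + 1 or q = 2^m − 1 for some positive integer m. -/

import Mathlib

open scoped ComplexOrder

noncomputable section

/-- `χ : G → ℂ` is an irreducible character: the character of a simple
finite-dimensional complex representation of `G`. -/
def IsIrrChar (G : Type) [Group G] (χ : G → ℂ) : Prop :=
  ∃ V : FDRep ℂ G, CategoryTheory.Simple V ∧ χ = V.character

/-- A virtual character is a `ℤ`-linear combination of irreducible characters. -/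
def IsVirtualChar (G : Type) [Group G] (χ : G → ℂ) : Prop :=
  χ ∈ Submodule.span ℤ {f : G → ℂ | IsIrrChar G f}

open Classical in
/-- The regular character: `|G|` at the identity, `0` elsewhere. -/
def regChar (G : Type) [Group G] : G → ℂ :=
  fun g => if g = 1 then (Nat.card G : ℂ) else 0

/-- The Knutson index of `χ`: the least positive `n` such that `χ·φ = n·ρ_reg`
for some virtual character `φ`. -/
def KnutsonIndex (G : Type) [Group G] (χ : G → ℂ) : ℕ :=
  sInf {n : ℕ | 0 < n ∧ ∃ φ : G → ℂ, IsVirtualChar G φ ∧ χ * φ = n • regChar G}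

/-- `ℂ[G]` is of Knutson type: every irreducible character is regular invertible. -/
def IsKnutsonType (G : Type) [Group G] : Prop :=
  ∀ χ : G → ℂ, IsIrrChar G χ → ∃ φ : G → ℂ, IsVirtualChar G φ ∧ χ * φ = regChar G

/-- Savitskii's preorder: `φ ≤ χ` iff `φ(1) ≤ χ(1)` and every zero of `χ` is a zero of `φ`. -/
def SavitskiiLE (G : Type) [Group G] (φ χ : G → ℂ) : Prop :=
  φ 1 ≤ χ 1 ∧ ∀ g : G, χ g = 0 → φ g = 0

/-- A virtual character of positive degree is Savitskii-minimal if every virtual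
character of positive degree below it is also above it. -/
def SavitskiiMinimal (G : Type) [Group G] (χ : G → ℂ) : Prop :=
  ∀ φ : G → ℂ, IsVirtualChar G φ → 0 < φ 1 → SavitskiiLE G φ χ → SavitskiiLE G χ φ

end

namespace FiniteCharacter

open CategoryTheory Representation

section Basic

variable {G : Type} [Group G] [Fintype G]

/-- The bilinear form on functions on `G` for which irreducible characters are orthonormal. -/
noncomputable def charInner (f h : G → ℂ) : ℂ :=
  (Nat.card G : ℂ)⁻¹ * ∑ g, f g * h g⁻¹

/-- Functions which are constant on conjugacy classes. -/
def IsClassFn (f : G → ℂ) : Prop := ∀ g x, f (x * g * x⁻¹) = f g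

omit [Fintype G] in
theorem _root_.IsIrrChar.isClassFn {χ : G → ℂ} (h : IsIrrChar G χ) : IsClassFn χ := by
  obtain ⟨V, -, rfl⟩ := h
  exact fun g x => V.char_conj g x

omit [Fintype G] in
theorem card_ne_zero' [Finite G] : (Nat.card G : ℂ) ≠ 0 := by
  exact_mod_cast Nat.card_pos.ne'

theorem charInner_comm (f h : G → ℂ) : charInner f h = charInner h f := by
  unfold charInner
  congr 1
  exact Fintype.sum_equiv (Equiv.inv G) _ _ (fun g => by simp [mul_comm])

theorem charInner_smul_left (c : ℂ) (f h : G → ℂ) :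
    charInner (c • f) h = c * charInner f h := by
  simp only [charInner, Pi.smul_apply, smul_eq_mul, mul_assoc, ← Finset.mul_sum]
  ring

theorem charInner_sub_left (f₁ f₂ h : G → ℂ) :
    charInner (f₁ - f₂) h = charInner f₁ h - charInner f₂ h := by
  simp [charInner, sub_mul, Finset.sum_sub_distrib, mul_sub]

theorem charInner_smul_right (c : ℂ) (f h : G → ℂ) :
    charInner h (c • f) = c * charInner h f := by
  simp only [charInner_comm h, charInner_smul_left]

theorem charInner_sub_right (f₁ f₂ h : G → ℂ) :
    charInner h (f₁ - f₂) = charInner h f₁ - charInner h f₂ := by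
  simp only [charInner_comm h, charInner_sub_left]

theorem charInner_sum_left {ι : Type*} (s : Finset ι) (f : ι → G → ℂ) (h : G → ℂ) :
    charInner (∑ i ∈ s, f i) h = ∑ i ∈ s, charInner (f i) h := by
  simp only [charInner, Finset.sum_apply, Finset.sum_mul]
  rw [Finset.sum_comm, Finset.mul_sum]

theorem charInner_regChar {f : G → ℂ} : charInner (regChar G) f = f 1 := by
  classical
  simp [charInner, regChar]

/-- A representation whose `Representation.IsIrreducible` holds is a simple object. -/
theorem isIrrChar_of_isIrreducible {V : Type} [AddCommGroup V] [Module ℂ V]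
    [FiniteDimensional ℂ V] (ρ : Representation ℂ G V) [IsIrreducible ρ] :
    IsIrrChar G ρ.character := by
  refine ⟨FDRep.of ρ, ?_, rfl⟩
  rw [FDRep.simple_iff_char_is_norm_one]
  have := invertibleOfNonzero (card_ne_zero' (G := G))
  have h := Representation.char_orthonormal ρ ρ
  rw [if_pos ⟨Representation.Equiv.refl ρ⟩, inv_mul_eq_one₀ card_ne_zero'] at h
  exact h.symm

theorem charInner_irr_self {χ : G → ℂ} (h : IsIrrChar G χ) : charInner χ χ = 1 := by
  obtain ⟨V, hV, rfl⟩ := h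
  have := invertibleOfNonzero (card_ne_zero' (G := G))
  have := FDRep.char_orthonormal V V
  rwa [if_pos ⟨Iso.refl V⟩] at this

theorem charInner_irr_ne {χ χ' : G → ℂ} (h : IsIrrChar G χ) (h' : IsIrrChar G χ') (hne : χ ≠ χ') :
    charInner χ χ' = 0 := by
  obtain ⟨V, hV, rfl⟩ := h
  obtain ⟨W, hW, rfl⟩ := h'
  have := invertibleOfNonzero (card_ne_zero' (G := G))
  have := FDRep.char_orthonormal V W
  rwa [if_neg fun ⟨i⟩ => hne (FDRep.char_iso i)] at this

/-- The action of a class function on a representation. -/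
noncomputable def classAction {V : Type} [AddCommGroup V] [Module ℂ V]
    (ρ : Representation ℂ G V) (f : G → ℂ) : V →ₗ[ℂ] V :=
  ∑ g, f g • ρ g⁻¹

theorem classAction_comm {V : Type} [AddCommGroup V] [Module ℂ V]
    (ρ : Representation ℂ G V) {f : G → ℂ} (hf : IsClassFn f) (x : G) :
    classAction ρ f ∘ₗ ρ x = ρ x ∘ₗ classAction ρ f := by
  ext v
  simp only [classAction, LinearMap.comp_apply, LinearMap.sum_apply, LinearMap.smul_apply,
    _root_.map_sum, map_smul]
  refine Fintype.sum_equiv (MulAut.conj x⁻¹).toEquiv _ _ fun g => ?_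
  simp only [MulEquiv.toEquiv_eq_coe, EquivLike.coe_coe, MulAut.conj_apply, hf g x⁻¹]
  rw [← Module.End.mul_apply, ← Module.End.mul_apply, ← map_mul, ← map_mul]
  simp [mul_assoc]

theorem classAction_eq_zero {f : G → ℂ} (hf : IsClassFn f)
    (h0 : ∀ χ, IsIrrChar G χ → charInner f χ = 0) (n : ℕ) :
    ∀ {V : Type} [AddCommGroup V] [Module ℂ V] [FiniteDimensional ℂ V]
      (ρ : Representation ℂ G V), Module.finrank ℂ V = n → classAction ρ f = 0 := by
  induction n using Nat.strong_induction_on with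
  | _ n ih =>
  intro V _ _ _ ρ hn
  by_cases hirr : IsIrreducible ρ
  · let A : IntertwiningMap ρ ρ := ⟨classAction ρ f, fun g => classAction_comm ρ hf g⟩
    obtain ⟨c, hc⟩ :=
      (IsIrreducible.algebraMap_intertwiningMap_bijective_of_isAlgClosed (ρ := ρ)).2 A
    have hA : classAction ρ f = c • LinearMap.id := by
      have : classAction ρ f = A.toLinearMap := rfl
      rw [this, ← hc]
      rfl
    have htr : LinearMap.trace ℂ V (classAction ρ f) = 0 := by
      have := h0 _ (isIrrChar_of_isIrreducible ρ)
      rw [charInner, mul_eq_zero_iff_left (inv_ne_zero card_ne_zero')] at this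
      simpa [classAction, Representation.character] using this
    rw [hA] at htr ⊢
    rw [map_smul, LinearMap.trace_id, smul_eq_mul, mul_eq_zero] at htr
    rcases htr with h | h
    · simp [h]
    · have : Subsingleton V := Module.finrank_zero_iff.1 (by exact_mod_cast h)
      ext v
      exact Subsingleton.elim _ _
  · by_cases hV : Subsingleton V
    · ext v
      exact Subsingleton.elim _ _
    have : Nontrivial V := not_subsingleton_iff_nontrivial.1 hV
    have hnt : Nontrivial (Subrepresentation ρ) := by
      refine ⟨⊥, ⊤, fun h => ?_⟩
      have := congrArg Subrepresentation.toSubmodule h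
      exact bot_ne_top (α := Submodule ℂ V) this
    have : ∃ S : Subrepresentation ρ, S ≠ ⊥ ∧ S ≠ ⊤ := by
      by_contra! hS
      exact hirr ⟨fun S => or_iff_not_imp_left.2 (hS S)⟩
    obtain ⟨S, hb, ht⟩ := this
    have hne : NeZero (Nat.card G : ℂ) := ⟨card_ne_zero'⟩
    have hss : IsSemisimpleRepresentation ρ := inferInstance
    obtain ⟨T, hST⟩ := hss.exists_isCompl S
    have hT : T ≠ ⊤ := by
      rintro rfl
      exact hb (by simpa using hST.inf_eq_bot)
    have key : ∀ S : Subrepresentation ρ, S ≠ ⊤ → ∀ v ∈ S.toSubmodule,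
        classAction ρ f v = 0 := by
      intro S hS v hv
      have hlt : Module.finrank ℂ S.toSubmodule < n := by
        rw [← hn]
        refine Submodule.finrank_lt (lt_top_iff_ne_top.2 fun h => hS ?_).ne
        exact Subrepresentation.toSubmodule_injective h
      have := LinearMap.congr_fun (ih _ hlt S.toRepresentation rfl) ⟨v, hv⟩
      have := congrArg Subtype.val this
      simpa [classAction, Subrepresentation.toRepresentation] using this
    ext v
    have hv : v ∈ (S ⊔ T).toSubmodule := by
      rw [hST.sup_eq_top]; exact Submodule.mem_top
    rw [Subrepresentation.toSubmodule_sup, Submodule.mem_sup] at hv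
    obtain ⟨a, ha, b, hb, rfl⟩ := hv
    simp [key S ht a ha, key T hT b hb]

/-- A class function orthogonal to all irreducible characters vanishes. -/
theorem eq_zero_of_charInner_eq_zero {f : G → ℂ} (hf : IsClassFn f)
    (h0 : ∀ χ, IsIrrChar G χ → charInner f χ = 0) : f = 0 := by
  have h := classAction_eq_zero hf h0 _ (Representation.leftRegular ℂ G) rfl
  ext g
  have := congrArg (fun A => (A (MonoidAlgebra.single 1 1)).coeff g⁻¹) h
  classical
  simpa [classAction, Finsupp.single_apply] using this

theorem finite_setOf_isIrrChar : {χ : G → ℂ | IsIrrChar G χ}.Finite := by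
  have hli : LinearIndependent ℂ (fun χ : {χ : G → ℂ | IsIrrChar G χ} => (χ : G → ℂ)) := by
    rw [linearIndependent_iff']
    intro s c hc i hi
    have := congrArg (fun f => charInner f (i : G → ℂ)) hc
    simp only [charInner_sum_left, charInner_smul_left] at this
    rw [Finset.sum_eq_single i, charInner_irr_self i.2] at this
    · simpa [charInner] using this
    · intro j _ hj
      rw [charInner_irr_ne j.2 i.2 (Subtype.coe_injective.ne hj), mul_zero]
    · exact fun h => absurd hi h
  exact hli.setFinite

/-- The finite set of irreducible characters. -/
noncomputable def irr (G : Type) [Group G] [Fintype G] : Finset (G → ℂ) :=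
  (finite_setOf_isIrrChar (G := G)).toFinset

theorem mem_irr {χ : G → ℂ} : χ ∈ irr G ↔ IsIrrChar G χ := by
  simp [irr]

omit [Fintype G] in
theorem isClassFn_sum {ι : Type*} (s : Finset ι) {f : ι → G → ℂ}
    (hf : ∀ i ∈ s, IsClassFn (f i)) : IsClassFn (∑ i ∈ s, f i) := by
  intro g x
  simp only [Finset.sum_apply]
  exact Finset.sum_congr rfl fun i hi => hf i hi g x

omit [Fintype G] in
theorem IsClassFn.smul {f : G → ℂ} (hf : IsClassFn f) (c : ℂ) : IsClassFn (c • f) := by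
  intro g x
  simp [hf g x]

omit [Fintype G] in
theorem IsClassFn.add {f h : G → ℂ} (hf : IsClassFn f) (hh : IsClassFn h) :
    IsClassFn (f + h) := by
  intro g x
  simp [hf g x, hh g x]

omit [Fintype G] in
theorem IsClassFn.sub {f h : G → ℂ} (hf : IsClassFn f) (hh : IsClassFn h) :
    IsClassFn (f - h) := by
  intro g x
  simp [hf g x, hh g x]

theorem IsClassFn.eq_sum {f : G → ℂ} (hf : IsClassFn f) :
    f = ∑ χ ∈ irr G, charInner f χ • χ := by
  classical
  rw [← sub_eq_zero]
  apply eq_zero_of_charInner_eq_zero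
  · exact hf.sub (isClassFn_sum _ fun χ hχ => (mem_irr.1 hχ).isClassFn.smul _)
  · intro χ hχ
    rw [charInner_sub_left, charInner_sum_left, Finset.sum_eq_single χ]
    · rw [charInner_smul_left, charInner_irr_self hχ, mul_one, sub_self]
    · intro χ' h' hne
      rw [charInner_smul_left, charInner_irr_ne (mem_irr.1 h') hχ hne, mul_zero]
    · exact fun h => absurd (mem_irr.2 hχ) h

theorem IsClassFn.charInner_self {f : G → ℂ} (hf : IsClassFn f) :
    charInner f f = ∑ χ ∈ irr G, charInner f χ ^ 2 := by
  conv_lhs => rw [hf.eq_sum]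
  rw [charInner_sum_left, ← hf.eq_sum]
  refine Finset.sum_congr rfl fun χ _ => ?_
  rw [charInner_smul_left, charInner_comm χ f, sq]

theorem isVirtualChar_of_charInner {f : G → ℂ} (hf : IsClassFn f)
    (h : ∀ χ, IsIrrChar G χ → ∃ n : ℤ, charInner f χ = n) : IsVirtualChar G f := by
  unfold IsVirtualChar
  rw [hf.eq_sum]
  refine Submodule.sum_mem _ fun χ hχ => ?_
  obtain ⟨n, hn⟩ := h χ (mem_irr.1 hχ)
  rw [hn, Int.cast_smul_eq_zsmul]
  exact Submodule.smul_mem _ _ (Submodule.subset_span (mem_irr.1 hχ))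

/-- If `f` has integral multiplicities and `n = ⟨f, χ⟩`, then `n² ≤ ⟨f, f⟩`. -/
theorem sq_le_charInner_self {f : G → ℂ} (hf : IsClassFn f)
    (h : ∀ χ, IsIrrChar G χ → ∃ n : ℤ, charInner f χ = n) {N : ℤ} (hN : charInner f f = N)
    {χ : G → ℂ} (hχ : IsIrrChar G χ) {n : ℤ} (hn : charInner f χ = n) : n ^ 2 ≤ N := by
  choose! m hm using h
  have hsum : ∑ χ ∈ irr G, m χ ^ 2 = N := by
    have := hf.charInner_self
    rw [hN, Finset.sum_congr rfl fun χ hχ => by rw [hm χ (mem_irr.1 hχ)]] at this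
    exact_mod_cast this.symm
  have hnm : n = m χ := by
    have := hm χ hχ
    rw [hn] at this
    exact_mod_cast this
  rw [← hsum, hnm]
  exact Finset.single_le_sum (f := fun χ => m χ ^ 2) (fun _ _ => sq_nonneg _) (mem_irr.2 hχ)

/-- A generalized character of norm one is, up to sign, every irreducible character it meets. -/
theorem eq_or_eq_neg_of_norm_one {f : G → ℂ} (hf : IsClassFn f)
    (h : ∀ χ, IsIrrChar G χ → ∃ n : ℤ, charInner f χ = n) (hN : charInner f f = 1)
    {χ : G → ℂ} (hχ : IsIrrChar G χ) (hne : charInner f χ ≠ 0) : χ = f ∨ χ = -f := by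
  choose! m hm using h
  have hsum : ∑ χ ∈ irr G, m χ ^ 2 = 1 := by
    have := hf.charInner_self
    rw [hN, Finset.sum_congr rfl fun χ hχ => by rw [hm χ (mem_irr.1 hχ)]] at this
    exact_mod_cast this.symm
  have hmχ : m χ ≠ 0 := by
    intro h0
    rw [hm χ hχ, h0] at hne
    simp at hne
  classical
  rw [← Finset.add_sum_erase _ _ (mem_irr.2 hχ)] at hsum
  have h1 : 0 < m χ ^ 2 := by positivity
  have h2 : 0 ≤ ∑ ψ ∈ (irr G).erase χ, m ψ ^ 2 := Finset.sum_nonneg fun _ _ => sq_nonneg _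
  have h3 : ∑ ψ ∈ (irr G).erase χ, m ψ ^ 2 = 0 := by omega
  rw [Finset.sum_eq_zero_iff_of_nonneg fun _ _ => sq_nonneg _] at h3
  have h4 : f = (m χ : ℂ) • χ := by
    conv_lhs => rw [hf.eq_sum]
    rw [Finset.sum_eq_single χ, hm χ hχ]
    · intro ψ hψ hne
      have := h3 ψ (Finset.mem_erase.2 ⟨hne, hψ⟩)
      rw [hm ψ (mem_irr.1 hψ), pow_eq_zero_iff two_ne_zero |>.1 this]
      simp
    · exact fun h => absurd (mem_irr.2 hχ) h
  have h5 : m χ ^ 2 = 1 := by omega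
  rcases sq_eq_one_iff.1 h5 with h | h
  · left; rw [h4, h]; simp
  · right; rw [h4, h]; simp

/-- A generalized character of norm one meets some irreducible character. -/
theorem exists_irr_of_norm_one {f : G → ℂ} (hf : IsClassFn f)
    (hN : charInner f f = 1) : ∃ χ, IsIrrChar G χ ∧ charInner f χ ≠ 0 := by
  by_contra! h
  rw [eq_zero_of_charInner_eq_zero hf h] at hN
  simp [charInner] at hN

theorem _root_.IsIrrChar.apply_one {χ : G → ℂ} (h : IsIrrChar G χ) : ∃ n : ℕ, 0 < n ∧ χ 1 = n := by
  obtain ⟨V, hV, rfl⟩ := h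
  refine ⟨Module.finrank ℂ V, ?_, V.char_one⟩
  rw [Nat.pos_iff_ne_zero]
  intro h0
  have hs : Subsingleton V := Module.finrank_zero_iff.1 h0
  have h1 := charInner_irr_self (G := G) ⟨V, hV, rfl⟩
  have : V.character = 0 := by
    ext g
    have : V.ρ g = 0 := by ext v; exact Subsingleton.elim _ _
    simp [FDRep.character, this]
  rw [this] at h1
  simp [charInner] at h1

omit [Fintype G] in
/-- The multiplicity of a linear character in the pullback of a character is an integer. -/
theorem _root_.IsIrrChar.exists_multiplicity {χ : G → ℂ} (h : IsIrrChar G χ) {H : Type} [Group H]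
    [Fintype H] (j : H →* G) (l : H →* ℂˣ) :
    ∃ n : ℤ, (Nat.card H : ℂ)⁻¹ * ∑ x, (l x : ℂ) * χ (j x)⁻¹ = n := by
  obtain ⟨V, -, rfl⟩ := h
  have := invertibleOfNonzero (card_ne_zero' (G := H))
  let ρ : Representation ℂ H V :=
    { toFun := fun x => ((l x)⁻¹ : ℂˣ).val • V.ρ (j x)
      map_one' := by simp
      map_mul' := fun x y => by
        ext v
        simp [smul_smul, mul_comm] }
  have hρ := card_inv_mul_sum_char_eq_finrank ρ
  refine ⟨(Module.finrank ℂ (invariants ρ) : ℕ), ?_⟩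
  rw [Int.cast_natCast, ← hρ]
  congr 1
  refine Fintype.sum_equiv (Equiv.inv H) _ _ fun x => ?_
  simp [Representation.character, FDRep.character, ρ]

end Basic

end FiniteCharacter

namespace FiniteCharacter

section Induction

variable {G : Type} [Group G]

open Classical in
/-- The extension by zero of a linear character of a subgroup. -/
noncomputable def extend (H : Subgroup G) (l : H →* ℂˣ) (g : G) : ℂ :=
  if h : g ∈ H then (l ⟨g, h⟩ : ℂ) else 0

theorem extend_of_mem {H : Subgroup G} (l : H →* ℂˣ) {g : G} (h : g ∈ H) :
    extend H l g = l ⟨g, h⟩ := dif_pos h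

theorem extend_of_notMem {H : Subgroup G} (l : H →* ℂˣ) {g : G} (h : g ∉ H) :
    extend H l g = 0 := dif_neg h

theorem extend_one_of_mem {H : Subgroup G} {g : G} (h : g ∈ H) :
    extend H 1 g = 1 := by
  rw [extend_of_mem _ h]; simp

theorem extend_apply_one {H : Subgroup G} (l : H →* ℂˣ) : extend H l 1 = 1 := by
  rw [extend_of_mem l H.one_mem]
  have : (⟨1, H.one_mem⟩ : H) = 1 := rfl
  simp [this]

variable [Fintype G]

theorem sum_extend_mul (H : Subgroup G) [Fintype H] (l : H →* ℂˣ) (f : G → ℂ) :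
    ∑ g, extend H l g * f g = ∑ h : H, (l h : ℂ) * f h := by
  classical
  have h1 : ∑ g, extend H l g * f g = ∑ g with g ∈ H, extend H l g * f g := by
    rw [Finset.sum_filter]
    refine Finset.sum_congr rfl fun g _ => ?_
    split_ifs with h
    · rfl
    · rw [extend_of_notMem l h, zero_mul]
  rw [h1, Finset.sum_subtype (p := fun g => g ∈ H) _ (by simp)]
  refine Finset.sum_congr rfl fun h _ => ?_
  rw [extend_of_mem l h.2]

/-- The class function induced from a linear character of a subgroup. -/
noncomputable def ind (H : Subgroup G) (l : H →* ℂˣ) (g : G) : ℂ :=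
  (Nat.card H : ℂ)⁻¹ * ∑ x, extend H l (x * g * x⁻¹)

theorem isClassFn_ind (H : Subgroup G) (l : H →* ℂˣ) : IsClassFn (ind H l) := by
  intro g x
  unfold ind
  congr 1
  exact Fintype.sum_equiv (Equiv.mulRight x) _ _ fun y => by simp [mul_assoc]

theorem charInner_ind (H : Subgroup G) (l : H →* ℂˣ) {f : G → ℂ} (hf : IsClassFn f) :
    charInner (ind H l) f = (Nat.card H : ℂ)⁻¹ * ∑ g, extend H l g * f g⁻¹ := by
  have key : ∀ x : G, ∑ g, extend H l (x * g * x⁻¹) * f g⁻¹ = ∑ g, extend H l g * f g⁻¹ := by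
    intro x
    refine Fintype.sum_equiv (MulAut.conj x).toEquiv _ _ fun g => ?_
    simp only [MulEquiv.toEquiv_eq_coe, EquivLike.coe_coe, MulAut.conj_apply]
    rw [← hf g⁻¹ x]
    simp [mul_assoc]
  unfold charInner ind
  simp only [mul_assoc, ← Finset.mul_sum, Finset.sum_mul]
  rw [Finset.sum_comm]
  simp only [← mul_assoc, key]
  rw [Finset.sum_const, Finset.card_univ, nsmul_eq_mul, ← Nat.card_eq_fintype_card]
  field_simp [card_ne_zero' (G := G)]

theorem charInner_ind' (H : Subgroup G) [Fintype H] (l : H →* ℂˣ) {f : G → ℂ}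
    (hf : IsClassFn f) :
    charInner (ind H l) f = (Nat.card H : ℂ)⁻¹ * ∑ h : H, (l h : ℂ) * f (h : G)⁻¹ := by
  rw [charInner_ind H l hf, sum_extend_mul H l fun g => f g⁻¹]

theorem exists_int_charInner_ind (H : Subgroup G) (l : H →* ℂˣ) {χ : G → ℂ}
    (hχ : IsIrrChar G χ) : ∃ n : ℤ, charInner (ind H l) χ = n := by
  classical
  rw [charInner_ind' H l hχ.isClassFn]
  exact hχ.exists_multiplicity H.subtype l

theorem ind_apply_one (H : Subgroup G) (l : H →* ℂˣ) :
    ind H l 1 = (Nat.card H : ℂ)⁻¹ * Nat.card G := by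
  simp [ind, extend_apply_one]

theorem ind_eq_zero {H : Subgroup G} (l : H →* ℂˣ) {g : G} (h : ∀ x, x * g * x⁻¹ ∉ H) :
    ind H l g = 0 := by
  simp [ind, extend_of_notMem l (h _)]

theorem sum_ind_one (H : Subgroup G) : ∑ g, ind H 1 g = Nat.card G := by
  classical
  have h := charInner_ind' H 1 (f := 1) (fun _ _ => rfl)
  simp only [charInner, Pi.one_apply, mul_one, MonoidHom.one_apply, Units.val_one,
    Finset.sum_const, Finset.card_univ, nsmul_eq_mul, ← Nat.card_eq_fintype_card] at h
  have hG := card_ne_zero' (G := G)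
  have hH := card_ne_zero' (G := H)
  rw [inv_mul_cancel₀ hH, inv_mul_eq_one₀ hG] at h
  exact h.symm

theorem isVirtualChar_ind (H : Subgroup G) (l : H →* ℂˣ) : IsVirtualChar G (ind H l) :=
  isVirtualChar_of_charInner (isClassFn_ind H l) fun _ h => exists_int_charInner_ind H l h

/-- A character of degree `|H|` vanishing on `H \ {1}` is regular invertible. -/
theorem exists_mul_eq_regChar_of_subgroup {χ : G → ℂ} (hχ : IsClassFn χ) (H : Subgroup G)
    (h1 : χ 1 = Nat.card H) (h0 : ∀ h ∈ H, h ≠ 1 → χ h = 0) :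
    ∃ φ : G → ℂ, IsVirtualChar G φ ∧ χ * φ = regChar G := by
  refine ⟨ind H 1, isVirtualChar_ind H 1, ?_⟩
  ext g
  rw [Pi.mul_apply, regChar]
  split_ifs with hg
  · rw [hg, h1, ind_apply_one, mul_inv_cancel_left₀ (card_ne_zero' (G := H))]
  · by_cases hx : ∃ x, x * g * x⁻¹ ∈ H
    · obtain ⟨x, hx⟩ := hx
      rw [← hχ g x, h0 _ hx, zero_mul]
      rwa [Ne, conj_eq_one_iff]
    · push Not at hx
      rw [ind_eq_zero _ hx, mul_zero]

omit [Fintype G] in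
/-- The average of a virtual character over a subgroup is an integer. -/
theorem _root_.IsVirtualChar.exists_average {φ : G → ℂ} (hφ : IsVirtualChar G φ)
    (H : Subgroup G) [Fintype H] :
    ∃ n : ℤ, (Nat.card H : ℂ)⁻¹ * ∑ h : H, φ h = n := by
  unfold IsVirtualChar at hφ
  induction hφ using Submodule.span_induction with
  | mem χ hχ =>
    obtain ⟨n, hn⟩ := IsIrrChar.exists_multiplicity hχ H.subtype 1
    refine ⟨n, hn ▸ ?_⟩
    congr 1
    exact Fintype.sum_equiv (Equiv.inv H) _ _ fun x => by simp
  | zero => exact ⟨0, by simp⟩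
  | add f h _ _ hf hh =>
    obtain ⟨a, ha⟩ := hf
    obtain ⟨b, hb⟩ := hh
    exact ⟨a + b, by simp only [Pi.add_apply, Finset.sum_add_distrib, mul_add, ha, hb, Int.cast_add]⟩
  | smul c f _ hf =>
    obtain ⟨a, ha⟩ := hf
    refine ⟨c * a, ?_⟩
    rw [Int.cast_mul, ← ha]
    simp only [Pi.smul_apply, zsmul_eq_mul, ← Finset.mul_sum]
    ring

theorem sum_extend_one (H : Subgroup G) :
    ∑ g, extend H 1 g = Nat.card H := by
  classical
  have := sum_extend_mul H 1 1
  simpa using this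

end Induction

section Duality

variable {A : Type} [Group A] [Fintype A]

theorem sum_linearChar (α : A →* ℂˣ) [Decidable (α = 1)] :
    ∑ a, (α a : ℂ) = if α = 1 then (Nat.card A : ℂ) else 0 := by
  classical
  have h := sum_hom_units ((Units.coeHom ℂ).comp α)
  have h2 : (Units.coeHom ℂ).comp α = 1 ↔ α = 1 := by
    constructor
    · intro h
      ext a
      simpa using DFunLike.congr_fun h a
    · rintro rfl
      ext a
      simp
  simp only [h2, MonoidHom.comp_apply, Units.coeHom_apply, ← Nat.card_eq_fintype_card] at h
  rw [h]
  split_ifs <;> simp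

variable [IsCyclic A]

theorem card_linearChar : Nat.card (A →* ℂˣ) = Nat.card A := by
  let _ : CommGroup A := IsCyclic.commGroup
  exact CommGroup.card_monoidHom_of_hasEnoughRootsOfUnity A ℂ

theorem finite_linearChar : Finite (A →* ℂˣ) := by
  let _ : CommGroup A := IsCyclic.commGroup
  exact Nat.finite_of_card_ne_zero (by rw [card_linearChar]; exact Nat.card_pos.ne')

theorem isCyclic_linearChar : IsCyclic (A →* ℂˣ) := by
  let _ : CommGroup A := IsCyclic.commGroup
  obtain ⟨e⟩ := CommGroup.monoidHom_mulEquiv_of_hasEnoughRootsOfUnity A ℂ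
  exact isCyclic_of_surjective e.symm e.symm.surjective

theorem sum_linearChar_apply [Fintype (A →* ℂˣ)] {a : A} (ha : a ≠ 1) :
    ∑ α : A →* ℂˣ, (α a : ℂ) = 0 := by
  let _ : CommGroup A := IsCyclic.commGroup
  obtain ⟨β, hβ⟩ := CommGroup.exists_apply_ne_one_of_hasEnoughRootsOfUnity A ℂ ha
  have h : ∑ α : A →* ℂˣ, (α a : ℂ) = β a * ∑ α : A →* ℂˣ, (α a : ℂ) := by
    rw [Finset.mul_sum]
    exact (Fintype.sum_equiv (Equiv.mulLeft β) _ _ fun α => by simp).symm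
  have h1 : (β a : ℂ) - 1 ≠ 0 := fun h => hβ (by ext; simpa [sub_eq_zero] using h)
  have h2 : ((β a : ℂ) - 1) * ∑ α : A →* ℂˣ, (α a : ℂ) = 0 := by linear_combination -h
  exact (mul_eq_zero.1 h2).resolve_left h1

/-- Fourier inversion on a finite cyclic group. -/
theorem sum_multiplicity [Fintype (A →* ℂˣ)] (f : A → ℂ) (b : A) :
    ∑ α : A →* ℂˣ, ((Nat.card A : ℂ)⁻¹ * ∑ a, (α a : ℂ) * f a⁻¹) * α b = f b := by
  classical
  have h : ∀ a : A, ∑ α : A →* ℂˣ, (α a : ℂ) * f a⁻¹ * α b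
      = if a = b⁻¹ then Nat.card A * f b else 0 := by
    intro a
    split_ifs with hab
    · subst hab
      have : ∀ α : A →* ℂˣ, (α b⁻¹ : ℂ) * f b⁻¹⁻¹ * α b = f b := by
        intro α
        rw [inv_inv, mul_right_comm, ← Units.val_mul, ← map_mul]
        simp
      rw [Finset.sum_congr rfl fun α _ => this α, Finset.sum_const, Finset.card_univ,
        ← Nat.card_eq_fintype_card, card_linearChar, nsmul_eq_mul]
    · have : ∀ α : A →* ℂˣ, (α a : ℂ) * f a⁻¹ * α b = f a⁻¹ * α (a * b) := by
        intro α
        rw [map_mul, Units.val_mul]; ring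
      rw [Finset.sum_congr rfl fun α _ => this α, ← Finset.mul_sum, sum_linearChar_apply, mul_zero]
      rwa [Ne, mul_eq_one_iff_eq_inv]
  simp only [mul_assoc, ← Finset.mul_sum, Finset.sum_mul]
  rw [Finset.sum_comm]
  simp only [← mul_assoc, h]
  rw [Finset.sum_ite_eq' Finset.univ, if_pos (Finset.mem_univ _),
    inv_mul_cancel_left₀ card_ne_zero']

end Duality

section Torus

variable {G : Type} [Group G]

/-- `A` is a cyclic subgroup which is a trivial intersection set, inverted by the elements of
`N \ A`, all of which are involutions. -/
structure IsTorusPair (A N : Subgroup G) : Prop where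
  cyclic : IsCyclic A
  le : A ≤ N
  card_eq : Nat.card N = 2 * Nat.card A
  mul_self : ∀ n ∈ N, n ∉ A → n * n = 1
  mem_of_conj : ∀ a ∈ A, a ≠ 1 → ∀ x, x * a * x⁻¹ ∈ A → x ∈ N

namespace IsTorusPair

variable {A N : Subgroup G}

theorem conj_eq_self (h : IsTorusPair A N) {x a : G} (hx : x ∈ A) (ha : a ∈ A) :
    x * a * x⁻¹ = a := by
  have := h.cyclic
  let _ : CommGroup A := IsCyclic.commGroup
  have := congrArg Subtype.val (mul_comm (⟨x, hx⟩ : A) ⟨a, ha⟩)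
  rw [mul_inv_eq_iff_eq_mul]
  exact this

theorem conj_eq_inv (h : IsTorusPair A N) {n a : G} (hn : n ∈ N) (hnA : n ∉ A) (ha : a ∈ A) :
    n * a * n⁻¹ = a⁻¹ := by
  have h1 := h.mul_self n hn hnA
  have h2 := h.mul_self (n * a) (N.mul_mem hn (h.le ha))
    fun h' => hnA (by simpa using A.mul_mem h' (A.inv_mem ha))
  rw [← eq_inv_of_mul_eq_one_left h1, eq_inv_iff_mul_eq_one]
  simpa [mul_assoc] using h2

variable [Fintype G]

theorem ind_apply (h : IsTorusPair A N) (α : A →* ℂˣ) {a : A} (ha : a ≠ 1) :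
    ind A α a = α a + (α a⁻¹ : ℂˣ) := by
  have ha' : (a : G) ≠ 1 := by simpa using ha
  have key : ∀ x : G, extend A α (x * a * x⁻¹) =
      extend A 1 x * (α a - (α a⁻¹ : ℂˣ)) + extend N 1 x * (α a⁻¹ : ℂˣ) := by
    intro x
    by_cases hx : x ∈ A
    · rw [h.conj_eq_self hx a.2, extend_one_of_mem hx, extend_one_of_mem (h.le hx),
        extend_of_mem α a.2]
      ring
    by_cases hx' : x ∈ N
    · rw [h.conj_eq_inv hx' hx a.2, extend_of_notMem _ hx, extend_one_of_mem hx',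
        extend_of_mem α (A.inv_mem a.2), zero_mul, zero_add, one_mul]
      rfl
    · rw [extend_of_notMem _ hx, extend_of_notMem _ hx', extend_of_notMem _
        fun h' => hx' (h.mem_of_conj a a.2 ha' x h')]
      ring
  rw [ind, Finset.sum_congr rfl fun x _ => key x, Finset.sum_add_distrib, ← Finset.sum_mul,
    ← Finset.sum_mul, sum_extend_one, sum_extend_one, h.card_eq]
  have := card_ne_zero' (G := A)
  push_cast
  field_simp
  ring

end IsTorusPair

end Torus

section PSLTwoLike

variable {G : Type} [Group G] [Fintype G]

/-- Up to the regular character, the character induced from the trivial character of `U`; for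
`PSL₂(q)` it is the sum of the two Gelfand–Graev characters. -/
noncomputable def gelfandGraev (q : ℕ) (U : Subgroup G) : G → ℂ :=
  (2 / ((q : ℂ) - 1)) • (regChar G - ind U 1)

/-- The subgroup structure of `PSL₂(q)`: a Sylow subgroup `U` in the defining characteristic, and
two tori `A`, `C` of order `(q - ε) / 2` and `(q + ε) / 2` with normalizers `N` and `M`. -/
structure IsPSLTwoLike (q : ℕ) (ε : ℤ) (U A N C M : Subgroup G) : Prop where
  eps : ε = 1 ∨ ε = -1
  lt : 1 < q
  torus_left : IsTorusPair A N
  torus_right : IsTorusPair C M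
  card_left : 2 * (Nat.card A : ℤ) = q - ε
  card_right : 2 * (Nat.card C : ℤ) = q + ε
  card_unip : Nat.card U = q
  card_group : 2 * (Nat.card G : ℤ) = q * (q ^ 2 - 1)
  card_conj : ∀ u ∈ U, u ≠ 1 → 2 * (Nat.card {x : G // x * u * x⁻¹ ∈ U} : ℤ) = q * (q - 1)
  left_unip : ∀ a ∈ A, a ≠ 1 → ∀ x, x * a * x⁻¹ ∉ U
  right_unip : ∀ a ∈ C, a ≠ 1 → ∀ x, x * a * x⁻¹ ∉ U
  left_right : ∀ a ∈ A, a ≠ 1 → ∀ x, x * a * x⁻¹ ∉ C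
  exists_int : ∀ χ, IsIrrChar G χ → ∃ c : ℤ, charInner (gelfandGraev q U) χ = c

/-- The Deligne–Lusztig virtual character attached to a linear character of a torus. -/
noncomputable def delLus (q : ℕ) (ε : ℤ) (U A : Subgroup G) (α : A →* ℂˣ) : G → ℂ :=
  (ε : ℂ) • (ind A α - gelfandGraev q U)

omit [Fintype G] in
theorem conj_notMem_of_conj_notMem {H K : Subgroup G}
    (h : ∀ a ∈ H, a ≠ 1 → ∀ x, x * a * x⁻¹ ∉ K) :
    ∀ a ∈ K, a ≠ 1 → ∀ x, x * a * x⁻¹ ∉ H := by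
  intro a ha h1 x hx
  refine h _ hx (by rwa [Ne, conj_eq_one_iff]) x⁻¹ ?_
  simpa [mul_assoc] using ha

theorem isClassFn_regChar : IsClassFn (regChar G) := by
  intro g x
  have : x * g * x⁻¹ = 1 ↔ g = 1 := conj_eq_one_iff
  by_cases hg : g = 1
  · simp [regChar, hg]
  · rw [regChar, regChar, if_neg hg, if_neg (this.not.2 hg)]

theorem isClassFn_gelfandGraev (q : ℕ) (U : Subgroup G) : IsClassFn (gelfandGraev q U) :=
  (isClassFn_regChar.sub (isClassFn_ind _ _)).smul _

theorem isClassFn_delLus (q : ℕ) (ε : ℤ) (U A : Subgroup G) (α : A →* ℂˣ) :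
    IsClassFn (delLus q ε U A α) :=
  ((isClassFn_ind _ _).sub (isClassFn_gelfandGraev _ _)).smul _

omit [Fintype G] in
theorem sum_subgroup_of_const (H : Subgroup G) [Fintype H] (f : G → ℂ) (v : ℂ)
    (hf : ∀ h ∈ H, h ≠ 1 → f h = v) : ∑ h : H, f h = f 1 + (Nat.card H - 1) * v := by
  classical
  have : ∀ h : H, f h = v + if h = 1 then f 1 - v else 0 := by
    intro h
    split_ifs with h1
    · simp [h1]
    · rw [hf h h.2 (by simpa using h1), add_zero]
  rw [Finset.sum_congr rfl fun h _ => this h, Finset.sum_add_distrib, Finset.sum_ite_eq',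
    if_pos (Finset.mem_univ _), Finset.sum_const, Finset.card_univ, nsmul_eq_mul,
    ← Nat.card_eq_fintype_card]
  ring

namespace IsPSLTwoLike

variable {q : ℕ} {ε : ℤ} {U A N C M : Subgroup G}

theorem symm (h : IsPSLTwoLike q ε U A N C M) : IsPSLTwoLike q (-ε) U C M A N where
  eps := by rcases h.eps with h | h <;> simp [h]
  lt := h.lt
  torus_left := h.torus_right
  torus_right := h.torus_left
  card_left := by rw [h.card_right]; ring
  card_right := by rw [h.card_left]; ring
  card_unip := h.card_unip
  card_group := h.card_group
  card_conj := h.card_conj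
  left_unip := h.right_unip
  right_unip := h.left_unip
  left_right := conj_notMem_of_conj_notMem h.left_right
  exists_int := h.exists_int

theorem eps_mul_self (h : IsPSLTwoLike q ε U A N C M) : (ε : ℂ) * ε = 1 := by
  rcases h.eps with h | h <;> simp [h]

theorem q_ne_zero (h : IsPSLTwoLike q ε U A N C M) : (q : ℂ) ≠ 0 := by
  exact_mod_cast (zero_lt_one.trans h.lt).ne'

theorem q_sub_one_ne_zero (h : IsPSLTwoLike q ε U A N C M) : (q : ℂ) - 1 ≠ 0 := by
  rw [sub_ne_zero]
  exact_mod_cast h.lt.ne'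

theorem card_left' (h : IsPSLTwoLike q ε U A N C M) : (Nat.card A : ℂ) = (q - ε) / 2 := by
  have : ((2 * (Nat.card A : ℤ) : ℤ) : ℂ) = ((q - ε : ℤ) : ℂ) := by rw [h.card_left]
  push_cast at this
  linear_combination this / 2

theorem card_group' (h : IsPSLTwoLike q ε U A N C M) : (Nat.card G : ℂ) = q * (q ^ 2 - 1) / 2 := by
  have : ((2 * (Nat.card G : ℤ) : ℤ) : ℂ) = ((q * (q ^ 2 - 1) : ℤ) : ℂ) := by rw [h.card_group]
  push_cast at this
  linear_combination this / 2

theorem q_sub_eps_ne_zero (h : IsPSLTwoLike q ε U A N C M) : (q : ℂ) - ε ≠ 0 := by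
  intro h0
  have := h.card_left'
  rw [h0, zero_div] at this
  exact card_ne_zero' this

theorem gelfandGraev_one (h : IsPSLTwoLike q ε U A N C M) : gelfandGraev q U 1 = q ^ 2 - 1 := by
  have h1 := h.q_ne_zero
  have h2 := h.q_sub_one_ne_zero
  simp only [gelfandGraev, Pi.smul_apply, Pi.sub_apply, regChar, if_true, ind_apply_one,
    h.card_unip, h.card_group', smul_eq_mul]
  field_simp

theorem ind_unip (h : IsPSLTwoLike q ε U A N C M) {u : G} (hu : u ∈ U) (h1 : u ≠ 1) :
    ind U 1 u = (q - 1) / 2 := by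
  classical
  have hs : ∑ x, extend U 1 (x * u * x⁻¹) = Nat.card {x : G // x * u * x⁻¹ ∈ U} := by
    have : ∀ x, extend U 1 (x * u * x⁻¹) = if x * u * x⁻¹ ∈ U then 1 else 0 := by
      intro x
      split_ifs with hx
      · exact extend_one_of_mem hx
      · exact extend_of_notMem _ hx
    rw [Finset.sum_congr rfl fun x _ => this x, Finset.sum_boole, Nat.card_eq_fintype_card,
      Fintype.card_subtype]
  have h2 : ((2 * (Nat.card {x : G // x * u * x⁻¹ ∈ U} : ℤ) : ℤ) : ℂ) = ((q * (q - 1) : ℤ) : ℂ) := by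
    rw [h.card_conj u hu h1]
  push_cast at h2
  have := h.q_ne_zero
  rw [ind, hs, h.card_unip]
  field_simp
  linear_combination h2

theorem gelfandGraev_unip (h : IsPSLTwoLike q ε U A N C M) {u : G} (hu : u ∈ U) (h1 : u ≠ 1) :
    gelfandGraev q U u = -1 := by
  have h2 := h.q_sub_one_ne_zero
  simp only [gelfandGraev, Pi.smul_apply, Pi.sub_apply, regChar, if_neg h1, h.ind_unip hu h1,
    smul_eq_mul]
  field_simp
  ring

theorem gelfandGraev_eq_zero {g : G} (h1 : g ≠ 1) (hg : ∀ x, x * g * x⁻¹ ∉ U) :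
    gelfandGraev q U g = 0 := by
  simp [gelfandGraev, regChar, h1, ind_eq_zero _ hg]

theorem charInner_gelfandGraev (h : IsPSLTwoLike q ε U A N C M) {f : G → ℂ} (hf : IsClassFn f)
    (v : ℂ) (hv : ∀ u ∈ U, u ≠ 1 → f u = v) :
    charInner (gelfandGraev q U) f = 2 / q * (f 1 - v) := by
  classical
  have h1 := h.q_ne_zero
  have h2 := h.q_sub_one_ne_zero
  have h3 := sum_subgroup_of_const U (fun g => f g⁻¹) v fun u hu h1 =>
    hv _ (U.inv_mem hu) (inv_ne_one.2 h1)
  rw [gelfandGraev, charInner_smul_left, charInner_sub_left, charInner_regChar,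
    charInner_ind' U 1 hf]
  simp only [MonoidHom.one_apply, Units.val_one, one_mul]
  rw [h3, h.card_unip, inv_one]
  field_simp
  ring

theorem delLus_one (h : IsPSLTwoLike q ε U A N C M) (α : A →* ℂˣ) :
    delLus q ε U A α 1 = q + ε := by
  have h1 := h.q_sub_eps_ne_zero
  simp only [delLus, Pi.smul_apply, Pi.sub_apply, smul_eq_mul, ind_apply_one, h.gelfandGraev_one,
    h.card_left', h.card_group']
  have := h.eps_mul_self
  field_simp
  linear_combination (q ^ 2 : ℂ) * this

theorem delLus_unip (h : IsPSLTwoLike q ε U A N C M) (α : A →* ℂˣ) {u : G} (hu : u ∈ U)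
    (h1 : u ≠ 1) : delLus q ε U A α u = ε := by
  simp [delLus, h.gelfandGraev_unip hu h1,
    ind_eq_zero α (conj_notMem_of_conj_notMem h.left_unip u hu h1)]

theorem delLus_left (h : IsPSLTwoLike q ε U A N C M) (α : A →* ℂˣ) {a : A} (ha : a ≠ 1) :
    delLus q ε U A α a = ε * (α a + (α a⁻¹ : ℂˣ)) := by
  have h1 : (a : G) ≠ 1 := by simpa using ha
  simp [delLus, gelfandGraev_eq_zero h1 (h.left_unip a a.2 h1), h.torus_left.ind_apply α ha]

theorem delLus_right (h : IsPSLTwoLike q ε U A N C M) (α : A →* ℂˣ) {a : G} (ha : a ∈ C)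
    (h1 : a ≠ 1) : delLus q ε U A α a = 0 := by
  simp [delLus, gelfandGraev_eq_zero h1 (h.right_unip a ha h1),
    ind_eq_zero α (h.symm.left_right a ha h1)]

theorem charInner_delLus (h : IsPSLTwoLike q ε U A N C M) (α β : A →* ℂˣ)
    [Decidable (α = β)] [Decidable (α * β = 1)] :
    charInner (delLus q ε U A α) (delLus q ε U A β) =
      (if α = β then 1 else 0) + (if α * β = 1 then 1 else 0) := by
  classical
  have hc := isClassFn_delLus q ε U A β
  have h3 := charInner_ind' A α hc
  have h4 : ∀ a : A, (α a : ℂ) * delLus q ε U A β (a : G)⁻¹ =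
      (if a = 1 then (q - ε : ℂ) else 0) + ε * ((α * β⁻¹) a : ℂˣ) + ε * ((α * β) a : ℂˣ) := by
    intro a
    split_ifs with ha
    · subst ha
      simp only [map_one, Units.val_one, OneMemClass.coe_one, inv_one, h.delLus_one]
      ring
    · have := h.delLus_left β (a := a⁻¹) (inv_ne_one.2 ha)
      rw [← InvMemClass.coe_inv, this]
      simp
      ring
  rw [Finset.sum_congr rfl fun a _ => h4 a, Finset.sum_add_distrib, Finset.sum_add_distrib,
    Finset.sum_ite_eq', if_pos (Finset.mem_univ _), ← Finset.mul_sum, ← Finset.mul_sum,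
    sum_linearChar, sum_linearChar] at h3
  rw [delLus, charInner_smul_left, charInner_sub_left, h3,
    h.charInner_gelfandGraev hc ε (fun u hu h1 => h.delLus_unip β hu h1),
    h.delLus_one]
  have h1 := h.q_sub_eps_ne_zero
  have h2 := h.q_ne_zero
  have h5 := h.eps_mul_self
  have hab : α * β⁻¹ = 1 ↔ α = β := mul_inv_eq_one (G := A →* ℂˣ)
  simp only [hab]
  have h6 : (ε : ℂ) * ((Nat.card A : ℂ)⁻¹ * (q - ε) - 2 / q * (q + ε - ε)) = 0 := by
    rw [h.card_left']; field_simp; ring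
  have h7 := card_ne_zero' (G := A)
  have h8 : (Nat.card A : ℂ)⁻¹ * Nat.card A = 1 := inv_mul_cancel₀ h7
  split_ifs
  · linear_combination h6 + 2 * (ε * ε : ℂ) * h8 + 2 * h5
  · linear_combination h6 + (ε * ε : ℂ) * h8 + h5
  · linear_combination h6 + (ε * ε : ℂ) * h8 + h5
  · linear_combination h6

theorem charInner_delLus_one (h : IsPSLTwoLike q ε U A N C M) (α : A →* ℂˣ)
    [Decidable (α = 1)] :
    charInner (delLus q ε U A α) 1 = if α = 1 then (ε : ℂ) else 0 := by
  classical
  have hc : IsClassFn (1 : G → ℂ) := fun _ _ => rfl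
  have h3 := charInner_ind' A α hc
  simp only [Pi.one_apply, mul_one, sum_linearChar] at h3
  rw [delLus, charInner_smul_left, charInner_sub_left, h3,
    h.charInner_gelfandGraev hc 1 (fun u hu h1 => rfl)]
  have h7 := card_ne_zero' (G := A)
  split_ifs <;> simp

theorem exists_int_delLus (h : IsPSLTwoLike q ε U A N C M) (α : A →* ℂˣ) {χ : G → ℂ}
    (hχ : IsIrrChar G χ) : ∃ n : ℤ, charInner (delLus q ε U A α) χ = n := by
  obtain ⟨a, ha⟩ := exists_int_charInner_ind A α hχ
  obtain ⟨c, hc⟩ := h.exists_int χ hχ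
  exact ⟨ε * (a - c), by rw [delLus, charInner_smul_left, charInner_sub_left, ha, hc]; push_cast; rfl⟩

end IsPSLTwoLike

end PSLTwoLike

section Group

variable {Λ : Type*} [CommGroup Λ]

/-- Multiplication by an element of even order exchanges some subset with its complement. -/
theorem exists_finset_mul_mem_iff [Fintype Λ] {t : Λ} (ht : Even (orderOf t)) :
    ∃ S : Finset Λ, ∀ x, t * x ∈ S ↔ x ∉ S := by
  classical
  let rep : Λ → Λ := fun x => Quotient.out (x : Λ ⧸ Subgroup.zpowers t)
  have hrep : ∀ x, rep (t * x) = rep x := by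
    intro x
    have : ((t * x : Λ) : Λ ⧸ Subgroup.zpowers t) = x := by
      rw [eq_comm, QuotientGroup.eq, mul_comm t x, inv_mul_cancel_left]
      exact Subgroup.mem_zpowers t
    simp only [rep, this]
  have hmem : ∀ x, (rep x)⁻¹ * x ∈ Subgroup.zpowers t := by
    intro x
    rw [← QuotientGroup.eq]
    exact QuotientGroup.out_eq' _
  have heven : ∀ n : ℤ, t ^ n ∈ Subgroup.zpowers (t ^ (2 : ℤ)) ↔ Even n := by
    intro n
    constructor
    · rintro ⟨m, hm⟩
      simp only [← zpow_mul] at hm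
      have h1 := orderOf_dvd_sub_iff_zpow_eq_zpow.2 hm
      have h2 : (2 : ℤ) ∣ orderOf t := by exact_mod_cast ht.two_dvd
      have := h2.trans h1
      rw [even_iff_two_dvd]
      omega
    · rintro ⟨m, rfl⟩
      exact ⟨m, by simp only [← zpow_mul]; congr 1; ring⟩
  refine ⟨Finset.univ.filter fun x => (rep x)⁻¹ * x ∈ Subgroup.zpowers (t ^ (2 : ℤ)), fun x => ?_⟩
  obtain ⟨n, hn⟩ := hmem x
  have hn : t ^ n = (rep x)⁻¹ * x := hn
  have h1 : (rep x)⁻¹ * (t * x) = t ^ (n + 1) := by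
    rw [zpow_add_one, hn]
    exact mul_left_comm _ _ _ |>.trans (mul_comm _ _)
  simp only [Finset.mem_filter, Finset.mem_univ, true_and, hrep, h1, ← hn, heven]
  exact Int.even_add_one

theorem sum_eq_sum_add_of_mul_mem_iff [Fintype Λ] {t : Λ} {S : Finset Λ}
    (hS : ∀ x, t * x ∈ S ↔ x ∉ S) {E : Type*} [AddCommMonoid E] (f : Λ → E) :
    ∑ x, f x = ∑ x ∈ S, f x + ∑ x ∈ S, f (t * x) := by
  classical
  rw [← Finset.sum_add_sum_compl S]
  congr 1
  refine (Finset.sum_bij (fun x _ => t * x) ?_ ?_ ?_ ?_).symm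
  · intro x hx
    rw [Finset.mem_compl, hS, not_not]
    exact hx
  · intro x _ y _ hxy
    exact mul_left_cancel hxy
  · intro y hy
    refine ⟨t⁻¹ * y, ?_, mul_inv_cancel_left _ _⟩
    rw [Finset.mem_compl] at hy
    by_contra h
    rw [← hS, mul_inv_cancel_left] at h
    exact hy h
  · intro x _
    rfl

end Group

theorem eq_one_of_pow_eq_one_of_coprime {Λ : Type*} [Monoid Λ] {x : Λ} {m n : ℕ}
    (h : m.Coprime n) (hm : x ^ m = 1) (hn : x ^ n = 1) : x = 1 := by
  rw [← orderOf_eq_one_iff]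
  exact Nat.eq_one_of_dvd_coprimes h (orderOf_dvd_of_pow_eq_one hm) (orderOf_dvd_of_pow_eq_one hn)

theorem eq_one_of_mem_of_pow_eq_one {G : Type*} [Group G] {H : Subgroup G} {k : ℕ}
    (hH : Odd (Nat.card H)) {x : G} (hx : x ∈ H) (h2 : x ^ 2 ^ k = 1) : x = 1 := by
  have h1 : x ^ Nat.card H = 1 := congrArg Subtype.val (pow_card_eq_one' (x := (⟨x, hx⟩ : H)))
  exact eq_one_of_pow_eq_one_of_coprime (hH.coprime_two_right.pow_right k) h1 h2

section PSLTwoLike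

variable {G : Type} [Group G] [Fintype G]

theorem exists_int_charInner_one {χ : G → ℂ} (hχ : IsIrrChar G χ) :
    ∃ n : ℤ, charInner 1 χ = n := by
  obtain ⟨n, hn⟩ := hχ.exists_multiplicity (MonoidHom.id G) 1
  exact ⟨n, by simpa [charInner] using hn⟩

theorem charInner_one_one : charInner (1 : G → ℂ) 1 = 1 := by
  simp [charInner]

/-- A generalized character of norm one and positive degree is the irreducible character
it meets. -/
theorem eq_of_norm_one {f : G → ℂ} (hf : IsClassFn f)
    (h : ∀ χ, IsIrrChar G χ → ∃ n : ℤ, charInner f χ = n) (hN : charInner f f = 1)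
    {n : ℕ} (h1 : f 1 = n) {χ : G → ℂ} (hχ : IsIrrChar G χ) (hne : charInner f χ ≠ 0) :
    χ = f := by
  rcases eq_or_eq_neg_of_norm_one hf h hN hχ hne with h' | h'
  · exact h'
  · obtain ⟨m, hm, hm'⟩ := hχ.apply_one
    rw [h', Pi.neg_apply, h1] at hm'
    have : (m + n : ℂ) = 0 := by rw [← hm']; ring
    have : m + n = 0 := by exact_mod_cast this
    omega

theorem eq_one_of_charInner_one {χ : G → ℂ} (hχ : IsIrrChar G χ) (hne : charInner 1 χ ≠ 0) :
    χ = 1 :=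
  eq_of_norm_one (n := 1) (fun _ _ => rfl) (fun _ h => exists_int_charInner_one h)
    charInner_one_one (by simp) hχ hne

theorem ind_one_of_conj_mem {A N : Subgroup G} (h : IsTorusPair A N) {g x : G} (hg : g ≠ 1)
    (hx : x * g * x⁻¹ ∈ A) : ind A 1 g = 2 := by
  rw [← isClassFn_ind A 1 g x]
  have := h.ind_apply 1 (a := ⟨_, hx⟩) (by simpa [Subtype.ext_iff, conj_eq_one_iff] using hg)
  rw [this]
  norm_num

namespace IsPSLTwoLike

variable {q : ℕ} {ε : ℤ} {U A N C M : Subgroup G}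

theorem ind_left_one (h : IsPSLTwoLike q ε U A N C M) (α : A →* ℂˣ) :
    ind A α 1 = q * (q + ε) := by
  have h1 := h.q_sub_eps_ne_zero
  rw [ind_apply_one, h.card_left', h.card_group']
  field_simp
  linear_combination (q : ℂ) * h.eps_mul_self

theorem exists_conj_mem (h : IsPSLTwoLike q ε U A N C M) {g : G} (hg : g ≠ 1) :
    ∃ x, x * g * x⁻¹ ∈ A ∨ x * g * x⁻¹ ∈ C ∨ x * g * x⁻¹ ∈ U := by
  classical
  let P : G → Prop := fun g => ∃ x, x * g * x⁻¹ ∈ A ∨ x * g * x⁻¹ ∈ C ∨ x * g * x⁻¹ ∈ U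
  have h1 := h.q_sub_one_ne_zero
  have h2 := h.q_ne_zero
  have h3 := h.q_sub_eps_ne_zero
  have h4 := h.symm.q_sub_eps_ne_zero
  push_cast at h4
  have hT : ∀ g, (if g ≠ 1 ∧ ¬ P g then (1 : ℂ) else 0) =
      1 - (1 / 2 * ind A 1 g + 1 / 2 * ind C 1 g + 2 / (q - 1) * ind U 1 g)
        + if g = 1 then (q ^ 2 + q : ℂ) else 0 := by
    intro g
    by_cases hg : g = 1
    · subst hg
      rw [h.ind_left_one, h.symm.ind_left_one, ind_apply_one, h.card_unip, h.card_group']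
      push_cast
      simp only [ne_eq, not_true_eq_false, false_and, if_false, if_true]
      field_simp
      ring
    · by_cases hP : P g
      · rw [if_neg fun h' => h'.2 hP, if_neg hg]
        obtain ⟨x, hx | hx | hx⟩ := hP
        all_goals
          have hx1 : x * g * x⁻¹ ≠ 1 := by rwa [Ne, conj_eq_one_iff]
        · have e1 : ind C 1 g = 0 := by
            rw [← isClassFn_ind C 1 g x]; exact ind_eq_zero _ (h.left_right _ hx hx1)
          have e2 : ind U 1 g = 0 := by
            rw [← isClassFn_ind U 1 g x]; exact ind_eq_zero _ (h.left_unip _ hx hx1)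
          rw [e1, e2, ind_one_of_conj_mem h.torus_left hg hx]
          ring
        · have e1 : ind A 1 g = 0 := by
            rw [← isClassFn_ind A 1 g x]; exact ind_eq_zero _ (h.symm.left_right _ hx hx1)
          have e2 : ind U 1 g = 0 := by
            rw [← isClassFn_ind U 1 g x]; exact ind_eq_zero _ (h.right_unip _ hx hx1)
          rw [e1, e2, ind_one_of_conj_mem h.torus_right hg hx]
          ring
        · have e1 : ind A 1 g = 0 := by
            rw [← isClassFn_ind A 1 g x]
            exact ind_eq_zero _ (conj_notMem_of_conj_notMem h.left_unip _ hx hx1)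
          have e2 : ind C 1 g = 0 := by
            rw [← isClassFn_ind C 1 g x]
            exact ind_eq_zero _ (conj_notMem_of_conj_notMem h.right_unip _ hx hx1)
          rw [e1, e2, ← isClassFn_ind U 1 g x, h.ind_unip hx hx1]
          field_simp
          ring
      · rw [if_pos ⟨hg, hP⟩, if_neg hg]
        simp only [P, not_exists, not_or] at hP
        rw [ind_eq_zero _ fun x => (hP x).1, ind_eq_zero _ fun x => (hP x).2.1,
          ind_eq_zero _ fun x => (hP x).2.2]
        ring
  have hsum : ∑ g, (if g ≠ 1 ∧ ¬ P g then (1 : ℂ) else 0) = 0 := by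
    rw [Finset.sum_congr rfl fun g _ => hT g, Finset.sum_add_distrib, Finset.sum_sub_distrib,
      Finset.sum_add_distrib, Finset.sum_add_distrib, ← Finset.mul_sum, ← Finset.mul_sum,
      ← Finset.mul_sum, sum_ind_one, sum_ind_one, sum_ind_one, Finset.sum_ite_eq',
      if_pos (Finset.mem_univ _), Finset.sum_const, Finset.card_univ, nsmul_eq_mul,
      ← Nat.card_eq_fintype_card, h.card_group']
    field_simp
    ring
  rw [Finset.sum_boole, Nat.cast_eq_zero, Finset.card_eq_zero] at hsum
  by_contra hP
  have : g ∈ Finset.univ.filter fun g => g ≠ 1 ∧ ¬ P g := by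
    rw [Finset.mem_filter]
    exact ⟨Finset.mem_univ _, hg, hP⟩
  rw [hsum] at this
  simp at this

theorem classFn_ext (h : IsPSLTwoLike q ε U A N C M) {f f' : G → ℂ} (hf : IsClassFn f)
    (hf' : IsClassFn f') (h1 : f 1 = f' 1) (hA : ∀ a : A, a ≠ 1 → f a = f' a)
    (hC : ∀ a : C, a ≠ 1 → f a = f' a) (hU : ∀ u ∈ U, u ≠ 1 → f u = f' u) : f = f' := by
  ext g
  by_cases hg : g = 1
  · rw [hg, h1]
  obtain ⟨x, hx⟩ := h.exists_conj_mem hg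
  have hx1 : x * g * x⁻¹ ≠ 1 := by rwa [Ne, conj_eq_one_iff]
  rw [← hf g x, ← hf' g x]
  rcases hx with hx | hx | hx
  · exact hA ⟨_, hx⟩ fun h' => hx1 (congrArg Subtype.val h')
  · exact hC ⟨_, hx⟩ fun h' => hx1 (congrArg Subtype.val h')
  · exact hU _ hx hx1

theorem delLus_one_sub (h : IsPSLTwoLike q ε U A N C M) :
    delLus q ε U A 1 - delLus q (-ε) U C 1 = (2 * ε : ℂ) • (1 : G → ℂ) := by
  refine h.classFn_ext ((isClassFn_delLus _ _ _ _ _).sub (isClassFn_delLus _ _ _ _ _))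
    (IsClassFn.smul (fun _ _ => rfl) _) ?_ ?_ ?_ ?_
  · simp only [Pi.sub_apply, h.delLus_one, h.symm.delLus_one, Pi.smul_apply, Pi.one_apply,
      smul_eq_mul]
    push_cast
    ring
  · intro a ha
    simp only [Pi.sub_apply, h.delLus_left 1 ha, Pi.smul_apply, Pi.one_apply, smul_eq_mul,
      h.symm.delLus_right 1 a.2 (by simpa using ha), MonoidHom.one_apply, Units.val_one]
    ring
  · intro a ha
    simp only [Pi.sub_apply, h.symm.delLus_left 1 ha, Pi.smul_apply, Pi.one_apply, smul_eq_mul,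
      h.delLus_right 1 a.2 (by simpa using ha), MonoidHom.one_apply, Units.val_one]
    push_cast
    ring
  · intro u hu h1
    simp only [Pi.sub_apply, h.symm.delLus_unip 1 hu h1, h.delLus_unip 1 hu h1, Pi.smul_apply,
      Pi.one_apply, smul_eq_mul]
    push_cast
    ring

theorem isVirtualChar_delLus (h : IsPSLTwoLike q ε U A N C M) (α : A →* ℂˣ) :
    IsVirtualChar G (delLus q ε U A α) :=
  isVirtualChar_of_charInner (isClassFn_delLus _ _ _ _ _) fun _ hχ => h.exists_int_delLus α hχ

theorem charInner_delLus_self (h : IsPSLTwoLike q ε U A N C M) {α : A →* ℂˣ} (hα : α * α ≠ 1) :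
    charInner (delLus q ε U A α) (delLus q ε U A α) = 1 := by
  classical
  rw [h.charInner_delLus, if_pos rfl, if_neg hα, add_zero]

theorem exists_delLus_one_eq (h : IsPSLTwoLike q ε U A N C M) (α : A →* ℂˣ) :
    ∃ n : ℕ, delLus q ε U A α 1 = n := by
  have := h.symm.card_left
  refine ⟨2 * Nat.card C, ?_⟩
  rw [h.delLus_one, Nat.cast_mul, h.symm.card_left']
  push_cast
  ring

theorem eq_delLus (h : IsPSLTwoLike q ε U A N C M) {α : A →* ℂˣ} (hα : α * α ≠ 1)
    {χ : G → ℂ} (hχ : IsIrrChar G χ) (hne : charInner (delLus q ε U A α) χ ≠ 0) :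
    χ = delLus q ε U A α := by
  obtain ⟨n, hn⟩ := h.exists_delLus_one_eq α
  exact eq_of_norm_one (isClassFn_delLus _ _ _ _ _) (fun _ hχ => h.exists_int_delLus α hχ)
    (h.charInner_delLus_self hα) hn hχ hne

theorem exists_mul_delLus_left (h : IsPSLTwoLike q ε U A N C M) {α : A →* ℂˣ}
    (hα : Even (orderOf (α * α))) :
    ∃ φ : G → ℂ, IsVirtualChar G φ ∧ delLus q ε U A α * φ = regChar G := by
  classical
  have := h.torus_left.cyclic
  have := finite_linearChar (A := A)
  have := Fintype.ofFinite (A →* ℂˣ)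
  obtain ⟨S, hS⟩ := exists_finset_mul_mem_iff hα
  have hcard : 2 * (S.card : ℂ) = Nat.card A := by
    have h1 := sum_eq_sum_add_of_mul_mem_iff hS fun _ => (1 : ℂ)
    rw [Finset.sum_const, Finset.card_univ, ← Nat.card_eq_fintype_card, card_linearChar,
      Finset.sum_const, nsmul_one, nsmul_one] at h1
    rw [h1]; ring
  have hx : ∀ a : A, a ≠ 1 → (α a : ℂ) * α a ≠ -1 → ∑ β ∈ S, (β a : ℂ) = 0 := by
    intro a ha hne
    have h1 := sum_eq_sum_add_of_mul_mem_iff hS fun β => (β a : ℂ)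
    rw [sum_linearChar_apply ha] at h1
    simp only [MonoidHom.mul_apply, Units.val_mul, ← Finset.mul_sum] at h1
    have h2 : ((α a : ℂ) * α a + 1) * ∑ β ∈ S, (β a : ℂ) = 0 := by rw [add_mul, one_mul, h1]; ring
    exact (mul_eq_zero.1 h2).resolve_left fun h3 => hne (eq_neg_of_add_eq_zero_left h3)
  refine ⟨∑ β ∈ S, (delLus q ε U A β + delLus q (-ε) U C 1), ?_, ?_⟩
  · exact Submodule.sum_mem _ fun β _ => Submodule.add_mem _ (h.isVirtualChar_delLus β)
      (h.symm.isVirtualChar_delLus 1)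
  · have hcl : IsClassFn (∑ β ∈ S, (delLus q ε U A β + delLus q (-ε) U C 1)) :=
      isClassFn_sum _ fun β _ => (isClassFn_delLus _ _ _ _ _).add (isClassFn_delLus _ _ _ _ _)
    refine h.classFn_ext (fun g x => ?_) isClassFn_regChar ?_ ?_ ?_ ?_
    · rw [Pi.mul_apply, Pi.mul_apply, hcl g x, isClassFn_delLus q ε U A α g x]
    · simp only [Pi.mul_apply, Finset.sum_apply, Pi.add_apply, h.delLus_one, h.symm.delLus_one,
        Finset.sum_const, regChar, if_true, nsmul_eq_mul]
      have h5 := h.eps_mul_self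
      have h6 := h.card_left'
      rw [h.card_group']
      push_cast
      linear_combination (q * (q + ε) : ℂ) * hcard + (q * (q + ε) : ℂ) * h6 - (q / 2 : ℂ) * h5
    · intro a ha
      have ha' : (a : G) ≠ 1 := by simpa using ha
      rw [regChar, if_neg ha', Pi.mul_apply, Finset.sum_apply, h.delLus_left α ha]
      by_cases hαa : (α a : ℂ) * α a = -1
      · have : (α a : ℂ) + (α a⁻¹ : ℂˣ) = 0 := by
          rw [map_inv, Units.val_inv_eq_inv_val]
          field_simp
          linear_combination hαa
        rw [this]; ring
      · have hαi : (α a⁻¹ : ℂ) * α a⁻¹ ≠ -1 := by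
          intro hi
          apply hαa
          rw [map_inv, Units.val_inv_eq_inv_val] at hi
          field_simp at hi
          rw [sq] at hi
          linear_combination hi
        have : ∑ β ∈ S, (delLus q ε U A β + delLus q (-ε) U C 1) (a : G) =
            ε * (∑ β ∈ S, (β a : ℂ) + ∑ β ∈ S, (β a⁻¹ : ℂ)) := by
          simp only [Pi.add_apply, h.delLus_left _ ha, h.symm.delLus_right 1 a.2 ha', add_zero,
            ← Finset.mul_sum, Finset.sum_add_distrib]
        rw [this, hx a ha hαa, hx a⁻¹ (inv_ne_one.2 ha) hαi]
        ring
    · intro a ha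
      have ha' : (a : G) ≠ 1 := by simpa using ha
      rw [regChar, if_neg ha', Pi.mul_apply, h.delLus_right α a.2 ha', zero_mul]
    · intro u hu h1
      rw [regChar, if_neg h1, Pi.mul_apply, Finset.sum_apply, Finset.sum_eq_zero, mul_zero]
      intro β _
      rw [Pi.add_apply, h.delLus_unip β hu h1, h.symm.delLus_unip 1 hu h1]
      push_cast; ring

theorem odd_card_unip (h : IsPSLTwoLike q ε U A N C M) : Odd (Nat.card U) := by
  rw [h.card_unip]
  have := h.card_left
  rcases h.eps with h | h <;> rw [h] at this <;> rw [← Nat.not_even_iff_odd, even_iff_two_dvd] <;>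
    omega

theorem delLus_right_normalizer (h : IsPSLTwoLike q ε U A N C M) (hC : Odd (Nat.card C))
    (γ : C →* ℂˣ) {n : G} (hn : n ∈ N) (h1 : n ≠ 1) : delLus q (-ε) U C γ n = 0 := by
  by_cases hnA : n ∈ A
  · exact h.symm.delLus_right γ hnA h1
  · have h2 := h.torus_left.mul_self n hn hnA
    obtain ⟨x, hx⟩ := h.exists_conj_mem h1
    have hx1 : x * n * x⁻¹ ≠ 1 := by rwa [Ne, conj_eq_one_iff]
    have hx2 : (x * n * x⁻¹) ^ 2 ^ 1 = 1 := by
      rw [pow_one, conj_pow, sq, h2]; simp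
    rcases hx with hx | hx | hx
    · rw [← isClassFn_delLus q (-ε) U C γ n x]
      exact h.symm.delLus_right γ hx hx1
    · exact absurd (eq_one_of_mem_of_pow_eq_one hC hx hx2) hx1
    · exact absurd (eq_one_of_mem_of_pow_eq_one h.odd_card_unip hx hx2) hx1

theorem exists_mul_delLus_right (h : IsPSLTwoLike q ε U A N C M) (hC : Odd (Nat.card C))
    (γ : C →* ℂˣ) :
    ∃ φ : G → ℂ, IsVirtualChar G φ ∧ delLus q (-ε) U C γ * φ = regChar G := by
  refine exists_mul_eq_regChar_of_subgroup (isClassFn_delLus _ _ _ _ _) N ?_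
    fun n hn h1 => h.delLus_right_normalizer hC γ hn h1
  rw [h.symm.delLus_one, h.torus_left.card_eq, Nat.cast_mul, h.card_left']
  push_cast; ring

/-- An irreducible character meeting the virtual character attached to the trivial character of
the torus is trivial or the Steinberg character. -/
theorem exists_mul_of_charInner_delLus_one (h : IsPSLTwoLike q ε U A N C M) {χ : G → ℂ}
    (hχ : IsIrrChar G χ) (h1 : charInner 1 χ = 0) (hne : charInner (delLus q ε U A 1) χ ≠ 0) :
    ∃ φ : G → ℂ, IsVirtualChar G φ ∧ χ * φ = regChar G := by
  classical
  have hcl : IsClassFn (delLus q ε U A 1 - (ε : ℂ) • (1 : G → ℂ)) :=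
    (isClassFn_delLus _ _ _ _ _).sub (IsClassFn.smul (fun _ _ => rfl) _)
  have hSt1 : (delLus q ε U A 1 - (ε : ℂ) • (1 : G → ℂ)) 1 = q := by
    simp [h.delLus_one]
  have hSt : χ = delLus q ε U A 1 - (ε : ℂ) • 1 := by
    refine eq_of_norm_one hcl ?_ ?_ hSt1 hχ ?_
    · intro ψ hψ
      obtain ⟨a, ha⟩ := h.exists_int_delLus 1 hψ
      obtain ⟨b, hb⟩ := exists_int_charInner_one hψ
      exact ⟨a - ε * b, by rw [charInner_sub_left, charInner_smul_left, ha, hb]; push_cast; rfl⟩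
    · simp only [charInner_sub_left, charInner_sub_right, charInner_smul_left,
        charInner_smul_right, charInner_comm 1 (delLus q ε U A 1), h.charInner_delLus,
        h.charInner_delLus_one, charInner_one_one, mul_one, if_true, if_pos (one_mul (1 : A →* ℂˣ))]
      have := h.eps_mul_self
      linear_combination -this
    · rwa [charInner_sub_left, charInner_smul_left, h1, mul_zero, sub_zero]
  rw [hSt]
  refine exists_mul_eq_regChar_of_subgroup hcl U ?_ fun u hu h1 => ?_
  · rw [hSt1, h.card_unip]
  · simp [h.delLus_unip 1 hu h1]

theorem charInner_ind_eq (h : IsPSLTwoLike q ε U A N C M) (α : A →* ℂˣ) (χ : G → ℂ) :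
    charInner (ind A α) χ =
      charInner (gelfandGraev q U) χ + ε * charInner (delLus q ε U A α) χ := by
  rw [delLus, charInner_smul_left, charInner_sub_left]
  linear_combination (charInner (gelfandGraev q U) χ - charInner (ind A α) χ) * h.eps_mul_self

/-- An irreducible character meeting only the virtual characters attached to the quadratic
character of the even torus. -/
theorem exists_mul_of_charInner_eq_zero (h : IsPSLTwoLike q ε U A N C M) {χ : G → ℂ}
    (hχ : IsIrrChar G χ)
    (hγ : ∀ γ : C →* ℂˣ, charInner (delLus q (-ε) U C γ) χ = 0)
    (h1 : charInner (delLus q ε U A 1) χ = 0)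
    (hα : ∀ α : A →* ℂˣ, α * α ≠ 1 → charInner (delLus q ε U A α) χ = 0) :
    ∃ φ : G → ℂ, IsVirtualChar G φ ∧ χ * φ = regChar G := by
  classical
  have := h.torus_left.cyclic
  have := h.torus_right.cyclic
  have := finite_linearChar (A := A)
  have := finite_linearChar (A := C)
  have := Fintype.ofFinite (A →* ℂˣ)
  have := Fintype.ofFinite (C →* ℂˣ)
  obtain ⟨c, hc⟩ := h.exists_int χ hχ
  have hχC : ∀ b : C, χ b = c * ∑ γ : C →* ℂˣ, (γ b : ℂ) := by
    intro b
    rw [← sum_multiplicity (fun b : C => χ b) b, Finset.mul_sum]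
    refine Finset.sum_congr rfl fun γ _ => ?_
    have h2 := h.symm.charInner_ind_eq γ χ
    rw [charInner_ind' C γ hχ.isClassFn, hγ, mul_zero, add_zero, hc] at h2
    rw [← h2]
    rfl
  have hχC1 : χ 1 = c * Nat.card C := by
    have := hχC 1
    simpa [← Nat.card_eq_fintype_card, card_linearChar] using this
  obtain ⟨e, he, he2⟩ : ∃ e : ℤ, ∑ α : A →* ℂˣ, charInner (delLus q ε U A α) χ = e ∧ e ≤ 1 := by
    by_cases hex : ∃ α₀ : A →* ℂˣ, α₀ ≠ 1 ∧ α₀ * α₀ = 1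
    · obtain ⟨α₀, h0, h00⟩ := hex
      obtain ⟨e, he⟩ := h.exists_int_delLus α₀ hχ
      refine ⟨e, ?_, ?_⟩
      · rw [Finset.sum_eq_single α₀, he]
        · intro α _ hne
          by_cases hα1 : α = 1
          · rw [hα1, h1]
          refine hα α fun hαα => ?_
          have := isCyclic_linearChar (A := A)
          have hle := IsCyclic.card_pow_eq_one_le (α := A →* ℂˣ) (n := 2) two_pos
          have hsub : ({1, α₀, α} : Finset (A →* ℂˣ)) ⊆
              Finset.univ.filter fun a => a ^ 2 = 1 := by
            intro β hβ
            simp only [Finset.mem_insert, Finset.mem_singleton] at hβ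
            rcases hβ with rfl | rfl | rfl <;> simp [sq, h00, hαα]
          have h3 : ({1, α₀, α} : Finset (A →* ℂˣ)).card = 3 := by
            rw [Finset.card_eq_three]
            exact ⟨_, _, _, h0.symm, Ne.symm hα1, hne.symm, rfl⟩
          have := Finset.card_le_card hsub
          omega
        · exact fun h => absurd (Finset.mem_univ _) h
      · have := sq_le_charInner_self (N := 2) (isClassFn_delLus _ _ _ _ _)
          (fun _ hχ => h.exists_int_delLus α₀ hχ)
          (by rw [h.charInner_delLus, if_pos rfl, if_pos h00]; norm_num) hχ he
        nlinarith
    · push Not at hex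
      refine ⟨0, ?_, zero_le_one⟩
      rw [Int.cast_zero]
      refine Finset.sum_eq_zero fun α _ => ?_
      by_cases hα1 : α = 1
      · rw [hα1, h1]
      · exact hα α (hex α hα1)
  have hχA : χ 1 = c * Nat.card A + ε * e := by
    have h2 := sum_multiplicity (fun b : A => χ b) 1
    rw [OneMemClass.coe_one] at h2
    rw [← h2, ← he, Finset.mul_sum]
    have : ∀ α : A →* ℂˣ, ((Nat.card A : ℂ)⁻¹ * ∑ a : A, (α a : ℂ) * χ (a⁻¹ : A)) * α 1 =
        c + ε * charInner (delLus q ε U A α) χ := by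
      intro α
      have h2 := h.charInner_ind_eq α χ
      rw [charInner_ind' A α hχ.isClassFn, hc] at h2
      rw [← h2]
      simp
    rw [Finset.sum_congr rfl fun α _ => this α, Finset.sum_add_distrib, Finset.sum_const,
      Finset.card_univ, ← Nat.card_eq_fintype_card, card_linearChar, nsmul_eq_mul]
    ring
  have hce : c = e := by
    have h5 := h.eps_mul_self
    have h6 := h.card_left'
    have h7 := h.symm.card_left'
    push_cast at h7
    rw [hχC1, h6, h7] at hχA
    have : (c : ℂ) = e := by
      linear_combination (ε : ℂ) * hχA + (e - c) * h5
    exact_mod_cast this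
  have hc1 : c = 1 := by
    obtain ⟨n, hn, hn'⟩ := hχ.apply_one
    rw [hn'] at hχC1
    have h3 : (n : ℤ) = c * Nat.card C := by exact_mod_cast hχC1
    have h4 : 0 < c := by
      by_contra! hc
      have := mul_nonpos_of_nonpos_of_nonneg hc (Nat.cast_nonneg (α := ℤ) (Nat.card C))
      omega
    omega
  refine exists_mul_eq_regChar_of_subgroup hχ.isClassFn C ?_ fun g hg hg1 => ?_
  · rw [hχC1, hc1, Int.cast_one, one_mul]
  · have := hχC ⟨g, hg⟩
    rwa [sum_linearChar_apply (fun h' => hg1 (congrArg Subtype.val h')), mul_zero] at this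

theorem isKnutsonType (h : IsPSLTwoLike q ε U A N C M) (hC : Odd (Nat.card C)) {k : ℕ}
    (hA : Nat.card A = 2 ^ k) : IsKnutsonType G := by
  classical
  intro χ hχ
  by_cases h1 : charInner 1 χ = 0
  swap
  · rw [eq_one_of_charInner_one hχ h1]
    exact exists_mul_eq_regChar_of_subgroup (fun _ _ => rfl) ⊥ (by simp) fun g hg h1 =>
      absurd (Subgroup.mem_bot.1 hg) h1
  by_cases hα : ∃ α : A →* ℂˣ, α * α ≠ 1 ∧ charInner (delLus q ε U A α) χ ≠ 0
  · obtain ⟨α, hα, hne⟩ := hα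
    rw [h.eq_delLus hα hχ hne]
    have := h.torus_left.cyclic
    have hd : orderOf (α * α) ∣ 2 ^ k := by
      rw [← hA, ← card_linearChar]
      exact orderOf_dvd_natCard _
    obtain ⟨j, -, hj⟩ := (Nat.dvd_prime_pow Nat.prime_two).1 hd
    have hj0 : j ≠ 0 := by
      rintro rfl
      exact hα (orderOf_eq_one_iff.1 hj)
    exact h.exists_mul_delLus_left (hj ▸ (even_two.pow_of_ne_zero hj0))
  push Not at hα
  by_cases hγ : ∃ γ : C →* ℂˣ, γ * γ ≠ 1 ∧ charInner (delLus q (-ε) U C γ) χ ≠ 0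
  · obtain ⟨γ, hγ, hne⟩ := hγ
    rw [h.symm.eq_delLus hγ hχ hne]
    exact h.exists_mul_delLus_right hC γ
  push Not at hγ
  by_cases hA1 : charInner (delLus q ε U A 1) χ = 0
  swap
  · exact h.exists_mul_of_charInner_delLus_one hχ h1 hA1
  refine h.exists_mul_of_charInner_eq_zero hχ (fun γ => ?_) hA1 hα
  by_cases hγγ : γ * γ = 1
  · have := h.torus_right.cyclic
    have hγ1 : γ = 1 := by
      have h2 : γ ^ Nat.card C = 1 := by rw [← card_linearChar]; exact pow_card_eq_one' (G := C →* ℂˣ)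
      exact eq_one_of_pow_eq_one_of_coprime hC.coprime_two_right h2 ((sq γ).trans hγγ)
    have h2 := congrArg (fun f => charInner f χ) h.delLus_one_sub
    simp only [charInner_sub_left, charInner_smul_left, h1, hA1] at h2
    rw [hγ1]
    linear_combination -h2
  · exact hγ γ hγγ

theorem exists_card_eq_two_pow (h : IsPSLTwoLike q ε U A N C M) (hC : Odd (Nat.card C))
    (hK : IsKnutsonType G) : ∃ k, Nat.card A = 2 ^ k := by
  classical
  by_contra hA
  obtain ⟨ℓ, hℓ, hdvd, hodd⟩ := (Nat.eq_two_pow_or_exists_odd_prime_and_dvd _).resolve_left hA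
  have := h.torus_left.cyclic
  have := finite_linearChar (A := A)
  have := Fact.mk hℓ
  obtain ⟨α, hα⟩ := exists_prime_orderOf_dvd_card' (G := A →* ℂˣ) ℓ (card_linearChar (A := A) ▸ hdvd)
  have hαα : α * α ≠ 1 := by
    intro h2
    have := orderOf_dvd_of_pow_eq_one ((sq α).trans h2)
    rw [hα, (Nat.prime_dvd_prime_iff_eq hℓ Nat.prime_two)] at this
    rw [this] at hodd
    exact absurd hodd (by decide)
  obtain ⟨χ, hχ, hne⟩ := exists_irr_of_norm_one (isClassFn_delLus _ _ _ _ _) (h.charInner_delLus_self hαα)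
  obtain ⟨φ, hφ, hmul⟩ := hK χ hχ
  rw [h.eq_delLus hαα hχ hne] at hmul
  obtain ⟨k, m, hm, hkm⟩ := Nat.exists_eq_two_pow_mul_odd (n := Nat.card A) Nat.card_pos.ne'
  have hG : Nat.card G = 2 * q * Nat.card A * Nat.card C := by
    have h1 := h.card_group
    have h2 := h.card_left
    have h3 := h.card_right
    have h4 : ε * ε = 1 := by rcases h.eps with h | h <;> simp [h]
    zify
    have : 4 * ((Nat.card A : ℤ) * Nat.card C) = q ^ 2 - 1 := by
      linear_combination (2 * (Nat.card C : ℤ)) * h2 + (q - ε) * h3 - h4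
    linarith [congrArg (fun z => (q : ℤ) * z) this]
  obtain ⟨P, hP⟩ := Sylow.exists_subgroup_card_pow_prime (G := G) 2 (n := k + 1)
    ⟨q * m * Nat.card C, by rw [hG, hkm]; ring⟩
  have hzero : ∀ g ∈ P, g ≠ 1 → φ g = 0 := by
    intro g hg hg1
    have h0 := congrFun hmul g
    rw [Pi.mul_apply, regChar, if_neg hg1] at h0
    refine (mul_eq_zero.1 h0).resolve_left ?_
    have hg2 : g ^ 2 ^ (k + 1) = 1 := by
      rw [← hP]
      exact congrArg Subtype.val (pow_card_eq_one' (x := (⟨g, hg⟩ : P)))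
    obtain ⟨x, hx⟩ := h.exists_conj_mem hg1
    have hx1 : x * g * x⁻¹ ≠ 1 := by rwa [Ne, conj_eq_one_iff]
    have hx2 : (x * g * x⁻¹) ^ 2 ^ (k + 1) = 1 := by rw [conj_pow, hg2]; simp
    rcases hx with hx | hx | hx
    · have h3 : α ⟨_, hx⟩ = 1 := by
        refine eq_one_of_pow_eq_one_of_coprime (hodd.coprime_two_right.pow_right (k + 1)) ?_ ?_
        · rw [← hα, ← MonoidHom.pow_apply, pow_orderOf_eq_one, MonoidHom.one_apply]
        · rw [← map_pow]
          have : (⟨x * g * x⁻¹, hx⟩ : A) ^ 2 ^ (k + 1) = 1 := Subtype.ext hx2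
          rw [this, map_one]
      have h4 := h.delLus_left α (a := ⟨_, hx⟩) fun h' => hx1 (congrArg Subtype.val h')
      rw [isClassFn_delLus q ε U A α g x, map_inv, h3] at h4
      rw [h4]
      have := h.eps_mul_self
      intro h5
      simp only [inv_one, Units.val_one] at h5
      have : (2 : ℂ) = 0 := by linear_combination (ε : ℂ) * h5 - 2 * this
      norm_num at this
    · exact absurd (eq_one_of_mem_of_pow_eq_one hC hx hx2) hx1
    · exact absurd (eq_one_of_mem_of_pow_eq_one h.odd_card_unip hx hx2) hx1
  obtain ⟨n, hn⟩ := hφ.exists_average P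
  rw [sum_subgroup_of_const P φ 0 hzero, hP, mul_zero, add_zero] at hn
  have hφ1 : φ 1 = q * Nat.card A := by
    have h0 := congrFun hmul 1
    rw [Pi.mul_apply, regChar, if_pos rfl, h.delLus_one, h.card_group'] at h0
    have h1 := h.symm.q_sub_eps_ne_zero
    push_cast at h1
    rw [sub_neg_eq_add] at h1
    apply mul_left_cancel₀ h1
    rw [h0, h.card_left']
    linear_combination (q / 2 : ℂ) * h.eps_mul_self
  have h2 : (2 * n : ℂ) = q * m := by
    rw [← hn, hφ1, hkm]
    push_cast
    field_simp
    ring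
  have h3 : 2 * n = ((q * m : ℕ) : ℤ) := by exact_mod_cast h2
  have h4 : Odd (q * m) := (h.card_unip ▸ h.odd_card_unip).mul hm
  obtain ⟨t, ht⟩ := h4
  omega

end IsPSLTwoLike

end PSLTwoLike

end FiniteCharacter

namespace SLTwo

open Matrix

section Field

variable {F : Type} [Field F]

lemma det_eq (x : SpecialLinearGroup (Fin 2) F) : x 0 0 * x 1 1 - x 0 1 * x 1 0 = 1 := by
  rw [← Matrix.det_fin_two, x.det_coe]

lemma ext_entries {x y : SpecialLinearGroup (Fin 2) F} (h₀₀ : x 0 0 = y 0 0)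
    (h₀₁ : x 0 1 = y 0 1) (h₁₀ : x 1 0 = y 1 0) (h₁₁ : x 1 1 = y 1 1) : x = y := by
  ext i j
  fin_cases i <;> fin_cases j <;> assumption

lemma mul_entry (x y : SpecialLinearGroup (Fin 2) F) (i j : Fin 2) :
    (x * y) i j = x i 0 * y 0 j + x i 1 * y 1 j := by
  simp [Matrix.mul_apply, Fin.sum_univ_two]

lemma neg_entry (x : SpecialLinearGroup (Fin 2) F) (i j : Fin 2) : (-x) i j = -x i j := rfl

lemma inv_entries (x : SpecialLinearGroup (Fin 2) F) :
    x⁻¹ 0 0 = x 1 1 ∧ x⁻¹ 0 1 = -x 0 1 ∧ x⁻¹ 1 0 = -x 1 0 ∧ x⁻¹ 1 1 = x 0 0 := by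
  rw [SpecialLinearGroup.SL2_inv_expl]
  simp

/-- The matrix with the given entries. -/
def ofEntries (a b c d : F) (h : a * d - b * c = 1) : SpecialLinearGroup (Fin 2) F :=
  ⟨!![a, b; c, d], by rw [Matrix.det_fin_two_of, h]⟩

section ofEntries

variable (a b c d : F) (h : a * d - b * c = 1)

@[simp] lemma ofEntries_zero_zero : ofEntries a b c d h 0 0 = a := rfl

@[simp] lemma ofEntries_zero_one : ofEntries a b c d h 0 1 = b := rfl

@[simp] lemma ofEntries_one_zero : ofEntries a b c d h 1 0 = c := rfl

@[simp] lemma ofEntries_one_one : ofEntries a b c d h 1 1 = d := rfl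

end ofEntries

lemma mem_center_iff (x : SpecialLinearGroup (Fin 2) F) :
    x ∈ Subgroup.center (SpecialLinearGroup (Fin 2) F) ↔ x = 1 ∨ x = -1 := by
  rw [Matrix.SpecialLinearGroup.mem_center_iff]
  constructor
  · rintro ⟨r, hr, hx⟩
    have h₀₀ : x 0 0 = r := by rw [← hx]; simp
    have h₀₁ : x 0 1 = 0 := by rw [← hx]; simp
    have h₁₀ : x 1 0 = 0 := by rw [← hx]; simp
    have h₁₁ : x 1 1 = r := by rw [← hx]; simp
    rw [Fintype.card_fin, sq, mul_self_eq_one_iff] at hr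
    rcases hr with rfl | rfl
    · left; apply ext_entries <;> simp [*]
    · right; apply ext_entries <;> simp [*]
  · rintro (rfl | rfl)
    · exact ⟨1, by simp, by simp⟩
    · exact ⟨-1, by simp, by rw [map_neg, map_one]; simp⟩

/-- The torus of matrices with rows `(a, b)` and `(d * b, a)`. -/
def torus (d : F) : Subgroup (SpecialLinearGroup (Fin 2) F) where
  carrier := {x | x 0 0 = x 1 1 ∧ x 1 0 = d * x 0 1}
  mul_mem' {x y} hx hy := by
    simp only [Set.mem_ofPred_eq, mul_entry] at *
    grind
  one_mem' := by simp
  inv_mem' {x} hx := by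
    obtain ⟨h₀₀, h₀₁, h₁₀, h₁₁⟩ := inv_entries x
    simp only [Set.mem_ofPred_eq, h₀₀, h₀₁, h₁₀, h₁₁] at *
    grind

/-- The normalizer of `torus d`. -/
def normTorus (d : F) : Subgroup (SpecialLinearGroup (Fin 2) F) where
  carrier := {x | (x 0 0 = x 1 1 ∧ x 1 0 = d * x 0 1) ∨ (x 1 1 = -x 0 0 ∧ x 1 0 = -(d * x 0 1))}
  mul_mem' {x y} hx hy := by
    simp only [Set.mem_ofPred_eq, mul_entry] at *
    grind
  one_mem' := by simp
  inv_mem' {x} hx := by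
    obtain ⟨h₀₀, h₀₁, h₁₀, h₁₁⟩ := inv_entries x
    simp only [Set.mem_ofPred_eq, h₀₀, h₀₁, h₁₀, h₁₁] at *
    grind

/-- The group of upper triangular unipotent matrices. -/
def unipotent (F : Type) [Field F] : Subgroup (SpecialLinearGroup (Fin 2) F) where
  carrier := {x | x 0 0 = 1 ∧ x 1 1 = 1 ∧ x 1 0 = 0}
  mul_mem' {x y} hx hy := by
    simp only [Set.mem_ofPred_eq, mul_entry] at *
    grind
  one_mem' := by simp
  inv_mem' {x} hx := by
    obtain ⟨h₀₀, h₀₁, h₁₀, h₁₁⟩ := inv_entries x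
    simp only [Set.mem_ofPred_eq, h₀₀, h₁₀, h₁₁] at *
    grind

/-- The group of upper triangular matrices. -/
def borel (F : Type) [Field F] : Subgroup (SpecialLinearGroup (Fin 2) F) where
  carrier := {x | x 1 0 = 0}
  mul_mem' {x y} hx hy := by
    simp only [Set.mem_ofPred_eq, mul_entry] at *
    grind
  one_mem' := by simp
  inv_mem' {x} hx := by
    obtain ⟨-, -, h₁₀, -⟩ := inv_entries x
    simp only [Set.mem_ofPred_eq, h₁₀] at *
    grind

lemma mem_torus {d : F} {x : SpecialLinearGroup (Fin 2) F} :
    x ∈ torus d ↔ x 0 0 = x 1 1 ∧ x 1 0 = d * x 0 1 := Iff.rfl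

lemma mem_normTorus {d : F} {x : SpecialLinearGroup (Fin 2) F} : x ∈ normTorus d ↔
    (x 0 0 = x 1 1 ∧ x 1 0 = d * x 0 1) ∨ (x 1 1 = -x 0 0 ∧ x 1 0 = -(d * x 0 1)) := Iff.rfl

lemma mem_unipotent {x : SpecialLinearGroup (Fin 2) F} :
    x ∈ unipotent F ↔ x 0 0 = 1 ∧ x 1 1 = 1 ∧ x 1 0 = 0 := Iff.rfl

lemma mem_borel {x : SpecialLinearGroup (Fin 2) F} : x ∈ borel F ↔ x 1 0 = 0 := Iff.rfl

lemma torus_le_normTorus (d : F) : torus d ≤ normTorus d := fun _ hx => Or.inl hx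

lemma center_le_torus (d : F) : Subgroup.center (SpecialLinearGroup (Fin 2) F) ≤ torus d := by
  intro x hx
  rcases (mem_center_iff x).mp hx with rfl | rfl <;> simp [mem_torus]

lemma center_le_borel : Subgroup.center (SpecialLinearGroup (Fin 2) F) ≤ borel F := by
  intro x hx
  rcases (mem_center_iff x).mp hx with rfl | rfl <;> simp [mem_borel]

lemma eq_one_or_eq_neg_one {d : F} {t : SpecialLinearGroup (Fin 2) F} (ht : t ∈ torus d)
    (h : t 0 1 = 0) : t = 1 ∨ t = -1 := by
  have hdet := det_eq t
  obtain ⟨h₁, h₂⟩ := ht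
  have h₀₀ : t 0 0 = 1 ∨ t 0 0 = -1 := by
    rw [← mul_self_eq_one_iff]
    grind
  rcases h₀₀ with h₀ | h₀
  · left; apply ext_entries <;> simp <;> grind
  · right; apply ext_entries <;> simp <;> grind

/-- The trace is invariant under conjugation. -/
lemma trace_conj (x g : SpecialLinearGroup (Fin 2) F) :
    (x * g * x⁻¹) 0 0 + (x * g * x⁻¹) 1 1 = g 0 0 + g 1 1 := by
  obtain ⟨h₀₀, h₀₁, h₁₀, h₁₁⟩ := inv_entries x
  have hdet := det_eq x
  simp only [mul_entry, h₀₀, h₀₁, h₁₀, h₁₁]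
  linear_combination (g 0 0 + g 1 1) * hdet

lemma mem_normTorus_of_conj (h2 : (2 : F) ≠ 0) {d : F} (hd : d ≠ 0)
    {g x : SpecialLinearGroup (Fin 2) F} (hg : g ∈ torus d) (hb : g 0 1 ≠ 0)
    (hx : x * g * x⁻¹ ∈ torus d) : x ∈ normTorus d := by
  obtain ⟨t, ht⟩ : ∃ t, t = x * g * x⁻¹ := ⟨_, rfl⟩
  have htr := trace_conj x g
  rw [← ht] at hx htr
  have hmul : t * x = x * g := by rw [ht]; group
  have e₀₀ := congr_arg (fun y : SpecialLinearGroup (Fin 2) F => y 0 0) hmul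
  have e₀₁ := congr_arg (fun y : SpecialLinearGroup (Fin 2) F => y 0 1) hmul
  have e₁₀ := congr_arg (fun y : SpecialLinearGroup (Fin 2) F => y 1 0) hmul
  have e₁₁ := congr_arg (fun y : SpecialLinearGroup (Fin 2) F => y 1 1) hmul
  simp only [mul_entry] at e₀₀ e₀₁ e₁₀ e₁₁
  have hdg := det_eq g
  have hdt := det_eq t
  obtain ⟨hg₁, hg₂⟩ := hg
  obtain ⟨ht₁, ht₂⟩ := hx
  have h00 : t 0 0 = g 0 0 := by
    apply mul_left_cancel₀ h2
    linear_combination htr + ht₁ - hg₁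
  have hsq : (t 0 1) ^ 2 = (g 0 1) ^ 2 := by
    apply mul_left_cancel₀ hd
    rw [← ht₁, h00, ht₂] at hdt
    rw [← hg₁, hg₂] at hdg
    linear_combination hdg - hdt
  rw [← ht₁, h00] at e₁₁ e₁₀
  rw [h00] at e₀₁ e₀₀
  rw [ht₂] at e₁₀ e₁₁
  rw [← hg₁] at e₀₁ e₁₁
  rw [hg₂] at e₀₀ e₁₀
  rcases sq_eq_sq_iff_eq_or_eq_neg.mp hsq with hb' | hb'
  · left
    constructor
    · apply mul_left_cancel₀ hb
      grind
    · apply mul_left_cancel₀ hb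
      grind
  · right
    constructor
    · apply mul_left_cancel₀ hb
      grind
    · apply mul_left_cancel₀ hb
      grind

lemma entry_eq_zero_of_conj (h2 : (2 : F) ≠ 0) {d : F} (hd : d ≠ 0)
    {g x : SpecialLinearGroup (Fin 2) F} (hg : g ∈ torus d) {ε : F} (hε : ε ^ 2 = 1)
    (hx : (x * g * x⁻¹) 0 0 + (x * g * x⁻¹) 1 1 = 2 * ε) : g 0 1 = 0 := by
  rw [trace_conj] at hx
  have hdg := det_eq g
  obtain ⟨hg₁, hg₂⟩ := hg
  have h00 : g 0 0 = ε := by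
    apply mul_left_cancel₀ h2
    linear_combination hx + hg₁
  rw [← pow_eq_zero_iff two_ne_zero]
  apply mul_left_cancel₀ hd
  rw [← hg₁, h00, hg₂] at hdg
  linear_combination hε - hdg

lemma isSquare_of_conj (h2 : (2 : F) ≠ 0) {d : F}
    {g x : SpecialLinearGroup (Fin 2) F} (hg : g ∈ torus 1) (hb : g 0 1 ≠ 0)
    (hx : x * g * x⁻¹ ∈ torus d) : IsSquare d := by
  have htr := trace_conj x g
  generalize x * g * x⁻¹ = t at hx htr
  have hdg := det_eq g
  have hdt := det_eq t
  obtain ⟨hg₁, hg₂⟩ := hg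
  obtain ⟨ht₁, ht₂⟩ := hx
  have h00 : t 0 0 = g 0 0 := by
    apply mul_left_cancel₀ h2
    linear_combination htr + ht₁ - hg₁
  have hsq : d * (t 0 1) ^ 2 = (g 0 1) ^ 2 := by
    rw [← ht₁, h00, ht₂] at hdt
    rw [← hg₁, hg₂] at hdg
    linear_combination hdg - hdt
  have ht : t 0 1 ≠ 0 := by
    intro h
    rw [h] at hsq
    apply hb
    rw [← pow_eq_zero_iff two_ne_zero, ← hsq]
    ring
  refine ⟨g 0 1 / t 0 1, ?_⟩
  field_simp
  exact hsq

lemma mul_self_of_mem_normTorus {d : F} {n : SpecialLinearGroup (Fin 2) F} (hn : n ∈ normTorus d)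
    (h : n ∉ torus d) : n * n = -1 := by
  obtain ⟨h₁, h₂⟩ := hn.resolve_left h
  have hdet := det_eq n
  apply ext_entries <;> simp [mul_entry] <;> grind

end Field

section TorusHom

variable {F K : Type} [Field F] [Field K] [Algebra F K]

/-- The eigenvalue of `torus d` on the eigenvector given by a square root of `d`. -/
def torusHom (d : F) (s : K) (hs : s ^ 2 = algebraMap F K d) : torus d →* K where
  toFun x := algebraMap F K (x.1 0 0) + algebraMap F K (x.1 0 1) * s
  map_one' := by simp
  map_mul' x y := by
    obtain ⟨x, hx⟩ := x
    obtain ⟨y, hy⟩ := y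
    obtain ⟨h₁, h₂⟩ := mem_torus.mp hx
    obtain ⟨h₃, h₄⟩ := mem_torus.mp hy
    simp only [Subgroup.coe_mul, mul_entry, map_add, map_mul, h₄, ← h₃]
    linear_combination - algebraMap F K (x 0 1) * algebraMap F K (y 0 1) * hs

lemma torusHom_apply {d : F} {s : K} (hs : s ^ 2 = algebraMap F K d) (x : torus d) :
    torusHom d s hs x = algebraMap F K (x.1 0 0) + algebraMap F K (x.1 0 1) * s := rfl

lemma torusHom_mul {d : F} {s : K} (hs : s ^ 2 = algebraMap F K d) (x : torus d) :
    torusHom d s hs x * (algebraMap F K (x.1 0 0) - algebraMap F K (x.1 0 1) * s) = 1 := by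
  obtain ⟨x, hx⟩ := x
  have hdet := congr_arg (algebraMap F K) (det_eq x)
  obtain ⟨h₁, h₂⟩ := mem_torus.mp hx
  rw [h₂, ← h₁] at hdet
  simp only [map_sub, map_mul, map_one] at hdet
  rw [torusHom_apply]
  linear_combination hdet - algebraMap F K (x 0 1) ^ 2 * hs

lemma torusHom_injective (h2 : (2 : F) ≠ 0) {d : F} (hd : d ≠ 0) {s : K}
    (hs : s ^ 2 = algebraMap F K d) : Function.Injective (torusHom d s hs) := by
  rw [injective_iff_map_eq_one]
  intro x hx
  have hmul := torusHom_mul hs x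
  rw [hx, one_mul] at hmul
  rw [torusHom_apply] at hx
  have h00 : x.1 0 0 = 1 := by
    apply mul_left_cancel₀ h2
    apply (algebraMap F K).injective
    simp only [map_mul, map_ofNat, map_one]
    linear_combination hx + hmul
  have hdet := det_eq x.1
  obtain ⟨h₁, h₂⟩ := mem_torus.mp x.2
  rw [h₂, ← h₁, h00] at hdet
  have h01 : x.1 0 1 = 0 := by
    rw [← pow_eq_zero_iff two_ne_zero]
    apply mul_left_cancel₀ hd
    linear_combination -hdet
  apply Subtype.ext
  apply ext_entries <;> simp <;> grind

variable [Fintype F]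

lemma mem_range_of_pow_card {z : K} (hz : z ^ Fintype.card F = z) :
    z ∈ Set.range (algebraMap F K) := by
  classical
  have h : (Polynomial.X ^ Fintype.card F - Polynomial.X : Polynomial F) =
      ∏ a : F, (Polynomial.X - Polynomial.C a) := by
    have hdeg := FiniteField.X_pow_card_sub_X_natDegree_eq F (Fintype.one_lt_card (α := F))
    have hroots := FiniteField.roots_X_pow_card_sub_X F
    have := Polynomial.prod_multiset_X_sub_C_of_monic_of_roots_card_eq
      (p := (Polynomial.X ^ Fintype.card F - Polynomial.X : Polynomial F))
      (Polynomial.monic_X_pow_sub (by simpa using Fintype.one_lt_card (α := F)))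
      (by rw [hroots, hdeg]; rfl)
    rw [← this, hroots]
    rfl
  have h' := congr_arg (Polynomial.aeval z) h
  rw [map_prod] at h'
  simp only [map_sub, map_pow, Polynomial.aeval_X, Polynomial.aeval_C, hz, sub_self] at h'
  obtain ⟨a, -, ha⟩ := Finset.prod_eq_zero_iff.mp h'.symm
  exact ⟨a, (sub_eq_zero.mp ha).symm⟩

lemma torusHom_pow_card {d : F} {s : K} (hs : s ^ 2 = algebraMap F K d) (x : torus d) :
    torusHom d s hs x ^ Fintype.card F =
      algebraMap F K (x.1 0 0) + algebraMap F K (x.1 0 1) * s ^ Fintype.card F := by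
  have h := map_add (FiniteField.frobeniusAlgHom F K) (algebraMap F K (x.1 0 0))
    (algebraMap F K (x.1 0 1) * s)
  rw [map_mul, AlgHom.commutes, AlgHom.commutes] at h
  simpa [FiniteField.coe_frobeniusAlgHom, torusHom_apply] using h

lemma range_torusHom (h2 : (2 : F) ≠ 0) {d : F} (hd : d ≠ 0) {s : K}
    (hs : s ^ 2 = algebraMap F K d) {n : ℕ}
    (hn : (n + 1 = Fintype.card F ∧ s ^ Fintype.card F = s) ∨
      (n = Fintype.card F + 1 ∧ s ^ Fintype.card F = -s)) :
    (torusHom d s hs).toHomUnits.range = rootsOfUnity n K := by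
  have h2K : (2 : K) ≠ 0 := by
    rw [← map_ofNat (algebraMap F K)]
    exact (map_ne_zero _).mpr h2
  have hs0 : s ≠ 0 := by
    rintro rfl
    rw [zero_pow two_ne_zero, eq_comm, map_eq_zero] at hs
    exact hd hs
  ext z
  rw [mem_rootsOfUnity', MonoidHom.mem_range]
  constructor
  · rintro ⟨x, rfl⟩
    rw [MonoidHom.coe_toHomUnits]
    have hp := torusHom_pow_card hs x
    have hm := torusHom_mul hs x
    rcases hn with ⟨hn, hsq⟩ | ⟨hn, hsq⟩
    · rw [hsq, ← torusHom_apply hs, ← hn, pow_succ] at hp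
      exact mul_right_cancel₀ (left_ne_zero_of_mul_eq_one hm) (by rw [hp, one_mul])
    · rw [hn, pow_succ, hp, hsq, mul_comm, mul_neg, ← sub_eq_add_neg, hm]
  · intro hz
    obtain ⟨w, hw⟩ : ∃ w : K, w = (z : K)⁻¹ := ⟨_, rfl⟩
    have hzw : (z : K) * w = 1 := by rw [hw, mul_inv_cancel₀ z.ne_zero]
    have hzw' : ((z : K) ^ Fintype.card F = z ∧ w ^ Fintype.card F = w ∧
        s ^ Fintype.card F = s) ∨ ((z : K) ^ Fintype.card F = w ∧ w ^ Fintype.card F = z ∧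
        s ^ Fintype.card F = -s) := by
      rcases hn with ⟨hn, hsq⟩ | ⟨hn, hsq⟩
      · have : (z : K) ^ Fintype.card F = z := by rw [← hn, pow_succ, hz, one_mul]
        exact Or.inl ⟨this, by rw [hw, inv_pow, this], hsq⟩
      · have : (z : K) ^ Fintype.card F = w := by
          rw [hn, pow_succ] at hz
          rw [hw, eq_inv_of_mul_eq_one_left hz]
        exact Or.inr ⟨this, by rw [hw, inv_pow, this, hw, inv_inv], hsq⟩
    obtain ⟨a, ha⟩ : ((z : K) + w) / 2 ∈ Set.range (algebraMap F K) := by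
      apply mem_range_of_pow_card
      have h := map_add (FiniteField.frobeniusAlgHom F K) (z : K) w
      have h' := map_ofNat (FiniteField.frobeniusAlgHom F K) 2
      simp only [FiniteField.coe_frobeniusAlgHom] at h h'
      rw [div_pow, h, h']
      rcases hzw' with ⟨e₁, e₂, -⟩ | ⟨e₁, e₂, -⟩ <;> rw [e₁, e₂]
      rw [add_comm]
    obtain ⟨b, hb⟩ : ((z : K) - w) / (2 * s) ∈ Set.range (algebraMap F K) := by
      apply mem_range_of_pow_card
      have h := map_sub (FiniteField.frobeniusAlgHom F K) (z : K) w
      have h' := map_ofNat (FiniteField.frobeniusAlgHom F K) 2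
      simp only [FiniteField.coe_frobeniusAlgHom] at h h'
      rw [div_pow, h, mul_pow, h']
      rcases hzw' with ⟨e₁, e₂, e₃⟩ | ⟨e₁, e₂, e₃⟩ <;> rw [e₁, e₂, e₃]
      field_simp
      ring
    have hz' : algebraMap F K a + algebraMap F K b * s = z := by
      rw [ha, hb]
      field_simp
      ring
    have hdet : a * a - b * (d * b) = 1 := by
      apply (algebraMap F K).injective
      simp only [map_sub, map_mul, map_one, ha, hb, ← hs]
      field_simp
      linear_combination 4 * hzw
    refine ⟨⟨ofEntries a b (d * b) a hdet, by simp [mem_torus]⟩, ?_⟩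
    apply Units.ext
    rw [MonoidHom.coe_toHomUnits, torusHom_apply]
    exact hz'

end TorusHom

section Count

variable {F : Type} [Field F] [Fintype F]

lemma natCard_torus_of_pow (h2 : (2 : F) ≠ 0) {d : F} (hd : d ≠ 0) {s : AlgebraicClosure F}
    (hs : s ^ 2 = algebraMap F _ d) {n : ℕ}
    (hn : (n + 1 = Fintype.card F ∧ s ^ Fintype.card F = s) ∨
      (n = Fintype.card F + 1 ∧ s ^ Fintype.card F = -s)) :
    Nat.card (torus d) = n := by
  have hn0 : (n : F) ≠ 0 := by
    have hq : (Fintype.card F : F) = 0 := Nat.cast_card_eq_zero F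
    rcases hn with ⟨hn, -⟩ | ⟨hn, -⟩
    · rw [← hn, Nat.cast_add, Nat.cast_one, add_eq_zero_iff_eq_neg] at hq
      rw [hq]
      simp
    · rw [hn]
      simp
  have : NeZero (n : F) := ⟨hn0⟩
  have : NeZero n := .of_neZero_natCast F
  have hinj : Function.Injective (torusHom d s hs).toHomUnits := fun x y h =>
    torusHom_injective h2 hd hs (congr_arg Units.val h)
  rw [Nat.card_congr (MonoidHom.ofInjective hinj).toEquiv, range_torusHom h2 hd hs hn,
    HasEnoughRootsOfUnity.natCard_rootsOfUnity]

lemma isCyclic_torus (h2 : (2 : F) ≠ 0) {d : F} (hd : d ≠ 0) : IsCyclic (torus d) := by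
  obtain ⟨s, hs⟩ := IsAlgClosed.exists_pow_nat_eq (algebraMap F (AlgebraicClosure F) d) two_pos
  exact isCyclic_of_injective_ringHom _ (torusHom_injective h2 hd hs)

lemma natCard_torus_one (h2 : (2 : F) ≠ 0) : Nat.card (torus (1 : F)) + 1 = Fintype.card F := by
  have hq := Fintype.card_pos (α := F)
  rw [natCard_torus_of_pow h2 one_ne_zero (s := 1) (n := Fintype.card F - 1) (by simp)
    (Or.inl ⟨by omega, by simp⟩)]
  omega

lemma natCard_torus (h2 : (2 : F) ≠ 0) {d : F} (hd : ¬ IsSquare d) :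
    Nat.card (torus d) = Fintype.card F + 1 := by
  have hd0 : d ≠ 0 := by
    rintro rfl
    exact hd IsSquare.zero
  obtain ⟨s, hs⟩ := IsAlgClosed.exists_pow_nat_eq (algebraMap F (AlgebraicClosure F) d) two_pos
  refine natCard_torus_of_pow h2 hd0 hs (Or.inr ⟨rfl, ?_⟩)
  have hsq : (s ^ Fintype.card F) ^ 2 = s ^ 2 := by
    rw [← pow_mul, mul_comm, pow_mul, hs, ← map_pow, FiniteField.pow_card]
  refine (sq_eq_sq_iff_eq_or_eq_neg.mp hsq).resolve_left fun h => hd ?_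
  obtain ⟨a, rfl⟩ := mem_range_of_pow_card h
  rw [← map_pow] at hs
  exact ⟨a, by rw [← sq, (algebraMap F (AlgebraicClosure F)).injective hs]⟩

lemma relIndex_torus (hq : Odd (Fintype.card F)) (h2 : (2 : F) ≠ 0) {d : F} (hd : d ≠ 0) :
    (torus d).relIndex (normTorus d) = 2 := by
  obtain ⟨p, r, hpr⟩ := FiniteField.exists_root_sum_quadratic
    (f := (Polynomial.X ^ 2 + Polynomial.C 1 : Polynomial F))
    (g := Polynomial.C (-d) * Polynomial.X ^ 2)
    (Polynomial.degree_X_pow_add_C two_pos 1)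
    (Polynomial.degree_C_mul_X_pow 2 (neg_ne_zero.mpr hd)) (Nat.odd_iff.mp hq)
  simp only [map_one, Polynomial.eval_add, Polynomial.eval_pow, Polynomial.eval_X,
    Polynomial.eval_one, Polynomial.eval_mul, Polynomial.eval_C] at hpr
  rw [Subgroup.relIndex_eq_two_iff_exists_notMem_and]
  refine ⟨ofEntries p r (-(d * r)) (-p) (by linear_combination -hpr), ?_, ?_, ?_⟩
  · simp [mem_normTorus]
  · rintro ⟨h₁, h₂⟩
    simp only [ofEntries_zero_zero, ofEntries_zero_one, ofEntries_one_zero,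
      ofEntries_one_one] at h₁ h₂
    have hp : p = 0 := mul_left_cancel₀ h2 (by linear_combination h₁)
    have hr : d * r = 0 := mul_left_cancel₀ h2 (by linear_combination -h₂)
    rw [hp] at hpr
    apply one_ne_zero (α := F)
    linear_combination hpr + r * hr
  · rintro b (hb | ⟨h₁, h₂⟩)
    · exact Or.inr hb
    · left
      simp only [mem_torus, mul_entry, ofEntries_zero_zero, ofEntries_zero_one,
        ofEntries_one_zero, ofEntries_one_one, h₁, h₂]
      constructor <;> ring

lemma natCard_unipotent : Nat.card (unipotent F) = Fintype.card F := by
  rw [← Nat.card_eq_fintype_card]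
  refine Nat.card_congr ⟨fun x => x.1 0 1, fun b => ⟨ofEntries 1 b 0 1 (by simp),
    by simp [mem_unipotent]⟩, fun x => ?_, fun b => rfl⟩
  obtain ⟨h₁, h₂, h₃⟩ := mem_unipotent.mp x.2
  apply Subtype.ext
  apply ext_entries <;> simp [*]

/-- Upper triangular matrices are parametrized by a diagonal and an upper right entry. -/
def borelEquiv (F : Type) [Field F] : Fˣ × F ≃ borel F where
  toFun p := ⟨ofEntries p.1 p.2 0 (p.1⁻¹ : Fˣ) (by simp), by simp [mem_borel]⟩
  invFun x :=
    have h : x.1 0 0 * x.1 1 1 = 1 := by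
      have hdet := det_eq x.1
      rw [mem_borel.mp x.2] at hdet
      linear_combination hdet
    ⟨⟨x.1 0 0, x.1 1 1, h, (mul_comm _ _).trans h⟩, x.1 0 1⟩
  left_inv p := by ext <;> simp
  right_inv x := Subtype.ext (ext_entries rfl rfl (mem_borel.mp x.2).symm rfl)

lemma natCard_borel :
    (Nat.card (borel F) : ℤ) = Fintype.card F * (Fintype.card F - 1) := by
  classical
  rw [← Nat.card_congr (borelEquiv F), Nat.card_prod, Nat.card_eq_fintype_card,
    Nat.card_eq_fintype_card, Fintype.card_units, Nat.cast_mul,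
    Nat.cast_sub Fintype.card_pos, Nat.cast_one, mul_comm]

lemma natCard_specialLinearGroup : (Nat.card (SpecialLinearGroup (Fin 2) F) : ℤ) =
    Fintype.card F * (Fintype.card F ^ 2 - 1) := by
  classical
  have hq := Fintype.one_lt_card (α := F)
  have hSL : Nat.card (SpecialLinearGroup (Fin 2) F) =
      Nat.card (GeneralLinearGroup.det (n := Fin 2) (R := F)).ker := by
    rw [Nat.card_congr (Equiv.ofInjective _
      (SpecialLinearGroup.toGL_injective (n := Fin 2) (R := F))), SpecialLinearGroup.range_toGL]
    rfl
  have hindex := (GeneralLinearGroup.det (n := Fin 2) (R := F)).ker.card_mul_index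
  rw [Subgroup.index_ker, MonoidHom.range_eq_top.mpr GeneralLinearGroup.det_surjective,
    Subgroup.card_top, ← hSL, Matrix.card_GL_field, Fin.prod_univ_two,
    Nat.card_eq_fintype_card (α := Fˣ), Fintype.card_units] at hindex
  have hpos : (Fintype.card F : ℤ) - 1 ≠ 0 := by omega
  apply mul_right_cancel₀ hpos
  zify at hindex
  rw [Nat.cast_sub hq.le, Nat.cast_sub (Nat.pow_le_pow_right (by omega) (by simp)),
    Nat.cast_sub (Nat.pow_le_pow_right (by omega) (by simp))] at hindex
  push_cast at hindex
  rw [hindex]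
  simp
  ring

omit [Fintype F] in
lemma natCard_center (h2 : (2 : F) ≠ 0) :
    Nat.card (Subgroup.center (SpecialLinearGroup (Fin 2) F)) = 2 := by
  have h : ((Subgroup.center (SpecialLinearGroup (Fin 2) F) :
      Set (SpecialLinearGroup (Fin 2) F))) = {1, -1} := by
    ext x
    simp [mem_center_iff]
  change Nat.card ((Subgroup.center (SpecialLinearGroup (Fin 2) F) :
      Set (SpecialLinearGroup (Fin 2) F))) = 2
  rw [h, Nat.card_coe_set_eq, Set.ncard_pair]
  intro h
  have := congr_arg (fun x : SpecialLinearGroup (Fin 2) F => x 0 0) h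
  simp at this
  apply h2
  linear_combination this

end Count

open FiniteCharacter

section Projective

variable {F : Type} [Field F]

/-- The projection of `SL₂(F)` onto `PSL₂(F)`. -/
abbrev proj (F : Type) [Field F] : SpecialLinearGroup (Fin 2) F →*
    SpecialLinearGroup (Fin 2) F ⧸ Subgroup.center (SpecialLinearGroup (Fin 2) F) :=
  QuotientGroup.mk' _

lemma proj_surjective : Function.Surjective (proj F) := QuotientGroup.mk'_surjective _

lemma ker_proj : (proj F).ker = Subgroup.center _ := QuotientGroup.ker_mk' _

lemma proj_eq_one_iff {x : SpecialLinearGroup (Fin 2) F} : proj F x = 1 ↔ x = 1 ∨ x = -1 := by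
  rw [← MonoidHom.mem_ker, ker_proj, mem_center_iff]

lemma proj_neg (x : SpecialLinearGroup (Fin 2) F) : proj F (-x) = proj F x := by
  rw [← neg_one_mul, map_mul, proj_eq_one_iff.mpr (Or.inr rfl), one_mul]

lemma proj_eq_iff {x y : SpecialLinearGroup (Fin 2) F} :
    proj F x = proj F y ↔ x = y ∨ x = -y := by
  constructor
  · intro h
    have h' : proj F (x * y⁻¹) = 1 := by rw [map_mul, map_inv, h, mul_inv_cancel]
    rcases proj_eq_one_iff.mp h' with h' | h'
    · exact Or.inl (mul_inv_eq_one.mp h')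
    · right
      rw [mul_inv_eq_iff_eq_mul] at h'
      rw [h', neg_one_mul]
  · rintro (rfl | rfl)
    · rfl
    · exact proj_neg y

lemma proj_mem_map_iff {H : Subgroup (SpecialLinearGroup (Fin 2) F)}
    (hH : Subgroup.center _ ≤ H) {x : SpecialLinearGroup (Fin 2) F} :
    proj F x ∈ H.map (proj F) ↔ x ∈ H := by
  rw [← Subgroup.mem_comap, Subgroup.comap_map_eq_self (by rwa [ker_proj])]

lemma proj_mem_map_unipotent_iff {x : SpecialLinearGroup (Fin 2) F} :
    proj F x ∈ (unipotent F).map (proj F) ↔ x ∈ unipotent F ∨ -x ∈ unipotent F := by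
  constructor
  · rintro ⟨u, hu, h⟩
    rcases proj_eq_iff.mp h with rfl | rfl
    · exact Or.inl hu
    · exact Or.inr hu
  · rintro (h | h)
    · exact ⟨x, h, rfl⟩
    · exact ⟨-x, h, proj_neg x⟩

lemma two_mul_natCard_map (h2 : (2 : F) ≠ 0) {H : Subgroup (SpecialLinearGroup (Fin 2) F)}
    (hH : Subgroup.center _ ≤ H) : 2 * Nat.card (H.map (proj F)) = Nat.card H := by
  have h := Subgroup.relIndex_mul_relIndex ⊥ _ _ bot_le (ker_proj.trans_le hH)
  rwa [Subgroup.relIndex_bot_left, Subgroup.relIndex_bot_left, Subgroup.relIndex_ker, ker_proj,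
    natCard_center h2] at h

lemma injOn_proj_unipotent (h2 : (2 : F) ≠ 0) : Set.InjOn (proj F) (unipotent F) := by
  intro x hx y hy h
  rcases proj_eq_iff.mp h with rfl | rfl
  · rfl
  · have h₁ := hx.1
    have h₂ := hy.1
    rw [neg_entry, h₂] at h₁
    exact absurd (by linear_combination -h₁) h2

lemma proj_ne_one {d : F} {t : SpecialLinearGroup (Fin 2) F} (ht : t ∈ torus d)
    (h : proj F t ≠ 1) : t 0 1 ≠ 0 := fun h' =>
  h (proj_eq_one_iff.mpr (eq_one_or_eq_neg_one ht h'))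

lemma conj_mem_map_unipotent_iff {u x : SpecialLinearGroup (Fin 2) F} (hu : u ∈ unipotent F)
    (hu1 : u 0 1 ≠ 0) : proj F x * proj F u * (proj F x)⁻¹ ∈ (unipotent F).map (proj F) ↔
      x ∈ borel F := by
  rw [← map_mul, ← map_inv, ← map_mul, proj_mem_map_unipotent_iff]
  obtain ⟨h₀₀, h₀₁, h₁₀, h₁₁⟩ := inv_entries x
  obtain ⟨e₁, e₂, e₃⟩ := hu
  have hdet := det_eq x
  simp only [mem_unipotent, neg_entry, mul_entry, h₀₀, h₀₁, h₁₀, h₁₁,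
    e₁, e₂, e₃, mem_borel]
  constructor
  · intro h
    have : x 1 0 * x 1 0 * u 0 1 = 0 := by
      rcases h with h | h
      · linear_combination -h.2.2
      · linear_combination h.2.2
    simpa [hu1] using this
  · intro h
    rw [h] at hdet ⊢
    left
    refine ⟨?_, ?_, ?_⟩
    · linear_combination hdet
    · linear_combination hdet
    · ring

lemma conj_notMem_map_unipotent (h2 : (2 : F) ≠ 0) {d : F} (hd : d ≠ 0) :
    ∀ a ∈ (torus d).map (proj F), a ≠ 1 → ∀ x, x * a * x⁻¹ ∉ (unipotent F).map (proj F) := by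
  rintro _ ⟨t, ht, rfl⟩ ha x hx
  obtain ⟨x, rfl⟩ := proj_surjective x
  rw [← map_mul, ← map_inv, ← map_mul, proj_mem_map_unipotent_iff] at hx
  refine proj_ne_one ht ha ?_
  rcases hx with ⟨h₁, h₂, -⟩ | ⟨h₁, h₂, -⟩
  · exact entry_eq_zero_of_conj (x := x) h2 hd ht (ε := 1) (by ring) (by rw [h₁, h₂]; ring)
  · simp only [neg_entry] at h₁ h₂
    exact entry_eq_zero_of_conj (x := x) h2 hd ht (ε := -1) (by ring)
      (by linear_combination -h₁ - h₂)

section Finite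

variable [Fintype F]

lemma isTorusPair (hq : Odd (Fintype.card F)) (h2 : (2 : F) ≠ 0) {d : F} (hd : d ≠ 0) :
    IsTorusPair ((torus d).map (proj F)) ((normTorus d).map (proj F)) where
  cyclic := by
    have := isCyclic_torus h2 hd
    exact isCyclic_of_surjective _ ((proj F).subgroupMap_surjective (torus d))
  le := Subgroup.map_mono (torus_le_normTorus d)
  card_eq := by
    have h₁ := two_mul_natCard_map h2 (center_le_torus d)
    have h₂ := two_mul_natCard_map h2 ((center_le_torus d).trans (torus_le_normTorus d))
    have h₃ := Subgroup.relIndex_mul_relIndex ⊥ _ _ bot_le (torus_le_normTorus d)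
    rw [Subgroup.relIndex_bot_left, Subgroup.relIndex_bot_left, relIndex_torus hq h2 hd] at h₃
    omega
  mul_self := by
    rintro _ ⟨n, hn, rfl⟩ hnT
    have : n ∉ torus d := fun h => hnT ⟨n, h, rfl⟩
    rw [← map_mul, mul_self_of_mem_normTorus hn this, proj_eq_one_iff]
    exact Or.inr rfl
  mem_of_conj := by
    rintro _ ⟨t, ht, rfl⟩ ha x hx
    obtain ⟨x, rfl⟩ := proj_surjective x
    rw [← map_mul, ← map_inv, ← map_mul, proj_mem_map_iff (center_le_torus d)] at hx
    exact ⟨x, mem_normTorus_of_conj h2 hd ht (proj_ne_one ht ha) hx, rfl⟩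

lemma natCard_conj_unipotent (h2 : (2 : F) ≠ 0) :
    ∀ u ∈ (unipotent F).map (proj F), u ≠ 1 →
      2 * (Nat.card {x // x * u * x⁻¹ ∈ (unipotent F).map (proj F)} : ℤ) =
        Fintype.card F * (Fintype.card F - 1) := by
  rintro _ ⟨u, hu, rfl⟩ hu1
  have hb : u 0 1 ≠ 0 := by
    intro h
    obtain ⟨h₁, h₂, h₃⟩ := mem_unipotent.mp hu
    exact hu1 (proj_eq_one_iff.mpr (Or.inl (ext_entries (by simpa) (by simpa) (by simpa)
      (by simpa))))
  have h : Nat.card {x // x * proj F u * x⁻¹ ∈ (unipotent F).map (proj F)} =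
      Nat.card ((borel F).map (proj F)) := by
    refine Nat.card_congr (Equiv.subtypeEquivRight fun x => ?_)
    obtain ⟨x, rfl⟩ := proj_surjective x
    rw [conj_mem_map_unipotent_iff hu hb, proj_mem_map_iff center_le_borel]
  rw [h, ← natCard_borel, ← two_mul_natCard_map h2 center_le_borel]
  push_cast
  rfl

/-- The diagonal matrices in `PSL₂(F)`. -/
def diagHom (F : Type) [Field F] : Fˣ →* SpecialLinearGroup (Fin 2) F where
  toFun a := ofEntries a 0 0 (a⁻¹ : Fˣ) (by simp)
  map_one' := by apply ext_entries <;> simp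
  map_mul' a b := by apply ext_entries <;> simp [mul_entry, mul_comm]

end Finite

end Projective

section Gelfand

variable {F : Type} [Field F] [Fintype F]

lemma sum_unipotent (h2 : (2 : F) ≠ 0)
    [Fintype ((unipotent F).map (proj F))]
    (f : SpecialLinearGroup (Fin 2) F ⧸ Subgroup.center (SpecialLinearGroup (Fin 2) F) → ℂ) :
    ∑ u : (unipotent F).map (proj F), f u =
      ∑ y : F, f (proj F (borelEquiv F (1, y))) := by
  symm
  refine Fintype.sum_bijective (fun y => ⟨proj F (borelEquiv F (1, y)), _,
    by simp [borelEquiv, mem_unipotent], rfl⟩) ⟨?_, ?_⟩ _ _ fun y => rfl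
  · intro y z h
    have h' := injOn_proj_unipotent h2 (by simp [borelEquiv, mem_unipotent])
      (by simp [borelEquiv, mem_unipotent]) (congr_arg Subtype.val h)
    exact congr_arg Prod.snd ((borelEquiv F).injective (Subtype.ext h'))
  · rintro ⟨_, x, hx, rfl⟩
    obtain ⟨h₁, h₂, h₃⟩ := mem_unipotent.mp hx
    refine ⟨x 0 1, Subtype.ext (congr_arg (proj F) ?_)⟩
    apply ext_entries <;> simp [borelEquiv, *]

omit [Fintype F] in
lemma borelEquiv_eq_conj {a : Fˣ} (h₁ : a ≠ 1) (h₂ : a ≠ -1) (y : F) :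
    ∃ x : SpecialLinearGroup (Fin 2) F, (borelEquiv F (a, y)).1 = x * diagHom F a * x⁻¹ := by
  have ha : ((a⁻¹ : Fˣ) : F) - a ≠ 0 := by
    intro h
    have h' : (a : F) * a = 1 := by
      have := a.mul_inv
      linear_combination this - (a : F) * h
    rcases mul_self_eq_one_iff.mp h' with h' | h'
    · exact h₁ (Units.ext h')
    · exact h₂ (Units.ext h')
  refine ⟨ofEntries 1 (y / ((a⁻¹ : Fˣ) - a)) 0 1 (by ring), ?_⟩
  rw [eq_mul_inv_iff_mul_eq]
  apply ext_entries <;> simp only [mul_entry] <;> simp [borelEquiv, diagHom]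
  have ha' : (a : F)⁻¹ - a ≠ 0 := by simpa using ha
  field_simp
  grind

lemma natCard_map_unipotent (h2 : (2 : F) ≠ 0) :
    Nat.card ((unipotent F).map (proj F)) = Fintype.card F := by
  rw [← natCard_unipotent]
  exact Nat.card_image_of_injOn (injOn_proj_unipotent h2)

lemma exists_charInner_gelfandGraev (h2 : (2 : F) ≠ 0)
    [Fintype (SpecialLinearGroup (Fin 2) F ⧸ Subgroup.center (SpecialLinearGroup (Fin 2) F))]
    {χ : SpecialLinearGroup (Fin 2) F ⧸ Subgroup.center (SpecialLinearGroup (Fin 2) F) → ℂ}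
    (hχ : IsIrrChar _ χ) : ∃ c : ℤ,
      charInner (gelfandGraev (Fintype.card F) ((unipotent F).map (proj F))) χ = c := by
  classical
  have hq := Fintype.one_lt_card (α := F)
  obtain ⟨m, hm⟩ := hχ.exists_multiplicity ((proj F).comp (diagHom F)) 1
  obtain ⟨n, hn⟩ := hχ.exists_multiplicity ((proj F).comp (borel F).subtype) 1
  have hdiff : ∀ a : Fˣ, ∑ y : F, χ (proj F (borelEquiv F (a, y)))⁻¹ =
      Fintype.card F * χ (proj F (diagHom F a))⁻¹ +
        ((if a = 1 then ∑ y : F, χ (proj F (borelEquiv F (1, y)))⁻¹ - Fintype.card F * χ 1 else 0) +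
        if a = -1 then ∑ y : F, χ (proj F (borelEquiv F (1, y)))⁻¹ - Fintype.card F * χ 1 else 0)
        := by
    intro a
    have hne : (1 : Fˣ) ≠ -1 := by
      intro h
      have := congr_arg Units.val h
      rw [Units.val_neg, Units.val_one] at this
      exact h2 (by linear_combination this)
    by_cases h₁ : a = 1
    · rw [if_pos h₁, if_neg (h₁ ▸ hne), h₁, map_one, map_one, inv_one]
      ring
    by_cases h₂ : a = -1
    · rw [if_pos h₂, if_neg h₁, h₂]
      have e : diagHom F (-1) = -1 := by
        apply ext_entries <;> simp [diagHom, neg_entry]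
      rw [e, proj_neg, map_one, inv_one]
      have : ∀ y : F, (borelEquiv F (-1, y)).1 = -(borelEquiv F (1, -y)).1 := by
        intro y
        apply ext_entries <;> simp [borelEquiv, neg_entry]
      simp only [this, proj_neg]
      have h := Equiv.sum_comp (Equiv.neg F) fun y => χ (proj F (borelEquiv F (1, y)))⁻¹
      simp only [Equiv.neg_apply] at h
      rw [h]
      ring
    · rw [if_neg h₁, if_neg h₂, add_zero, add_zero, ← nsmul_eq_mul, ← Finset.card_univ,
        ← Finset.sum_const]
      refine Finset.sum_congr rfl fun y _ => ?_
      obtain ⟨x, hx⟩ := borelEquiv_eq_conj h₁ h₂ y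
      rw [hx, map_mul, map_mul, map_inv, conj_inv, hχ.isClassFn]
  have hsum := Finset.sum_congr (rfl : (Finset.univ : Finset Fˣ) = _) fun a _ => hdiff a
  rw [← Fintype.sum_prod_type (fun p : Fˣ × F => χ (proj F (borelEquiv F (p.1, p.2)))⁻¹),
    (borelEquiv F).sum_comp (fun x => χ (proj F x)⁻¹), Finset.sum_add_distrib,
    Finset.sum_add_distrib, Finset.sum_ite_eq', Finset.sum_ite_eq', if_pos (Finset.mem_univ _),
    if_pos (Finset.mem_univ _), ← Finset.mul_sum] at hsum
  simp only [MonoidHom.one_apply, Units.val_one, one_mul] at hm hn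
  have hB := congr_arg (Int.cast (R := ℂ)) (natCard_borel (F := F))
  push_cast at hB
  have hq0 : (Fintype.card F : ℂ) ≠ 0 := Nat.cast_ne_zero.mpr (by omega)
  have hq1 : (Fintype.card F : ℂ) - 1 ≠ 0 := sub_ne_zero.mpr (by exact_mod_cast hq.ne')
  have hM : ∑ a : Fˣ, χ (proj F (diagHom F a))⁻¹ = (Fintype.card F - 1) * m := by
    rw [Nat.card_eq_fintype_card, Fintype.card_units, Nat.cast_sub hq.le, Nat.cast_one,
      inv_mul_eq_iff_eq_mul₀ hq1] at hm
    exact hm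
  have hN : ∑ x : borel F, χ (proj F x)⁻¹ = Fintype.card F * (Fintype.card F - 1) * n := by
    rw [hB, inv_mul_eq_iff_eq_mul₀ (mul_ne_zero hq0 hq1)] at hn
    exact hn
  rw [hM, hN] at hsum
  refine ⟨m - n, ?_⟩
  rw [gelfandGraev, charInner_smul_left, charInner_sub_left, charInner_regChar,
    charInner_ind' _ _ hχ.isClassFn, natCard_map_unipotent h2]
  simp only [MonoidHom.one_apply, Units.val_one, one_mul]
  rw [sum_unipotent h2 fun x => χ x⁻¹]
  push_cast
  field_simp
  linear_combination hsum

end Gelfand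

section Main

variable {F : Type} [Field F] [Fintype F]
  [Fintype (SpecialLinearGroup (Fin 2) F ⧸ Subgroup.center (SpecialLinearGroup (Fin 2) F))]

omit [Fintype (SpecialLinearGroup (Fin 2) F ⧸ Subgroup.center (SpecialLinearGroup (Fin 2) F))] in
lemma two_ne_zero_of_odd (hq : Odd (Fintype.card F)) : (2 : F) ≠ 0 := by
  intro h
  obtain ⟨k, hk⟩ := hq
  have h0 := Nat.cast_card_eq_zero F
  rw [hk] at h0
  push_cast at h0
  rw [h, zero_mul, zero_add] at h0
  exact one_ne_zero h0

omit [Fintype (SpecialLinearGroup (Fin 2) F ⧸ Subgroup.center (SpecialLinearGroup (Fin 2) F))] in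
lemma exists_not_isSquare (hq : Odd (Fintype.card F)) : ∃ d : F, ¬ IsSquare d := by
  refine FiniteField.exists_nonsquare fun h => two_ne_zero_of_odd hq ?_
  have := ringChar.of_eq h
  exact_mod_cast CharP.cast_eq_zero F 2

lemma isPSLTwoLike (hq : Odd (Fintype.card F)) {d : F} (hd : ¬ IsSquare d) :
    IsPSLTwoLike (Fintype.card F) 1 ((unipotent F).map (proj F))
      ((torus 1).map (proj F)) ((normTorus 1).map (proj F))
      ((torus d).map (proj F)) ((normTorus d).map (proj F)) := by
  have h2 := two_ne_zero_of_odd hq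
  have hd0 : d ≠ 0 := by
    rintro rfl
    exact hd IsSquare.zero
  refine
    { eps := Or.inl rfl
      lt := Fintype.one_lt_card
      torus_left := isTorusPair hq h2 one_ne_zero
      torus_right := isTorusPair hq h2 hd0
      card_left := ?_
      card_right := ?_
      card_unip := natCard_map_unipotent h2
      card_group := ?_
      card_conj := natCard_conj_unipotent h2
      left_unip := conj_notMem_map_unipotent h2 one_ne_zero
      right_unip := conj_notMem_map_unipotent h2 hd0
      left_right := ?_
      exists_int := fun χ hχ => exists_charInner_gelfandGraev h2 hχ }
  · have h₁ := two_mul_natCard_map h2 (center_le_torus (1 : F))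
    have h₂ := natCard_torus_one h2
    omega
  · have h₁ := two_mul_natCard_map h2 (center_le_torus d)
    have h₂ := natCard_torus h2 hd
    omega
  · rw [← natCard_specialLinearGroup, Subgroup.card_eq_card_quotient_mul_card_subgroup
      (Subgroup.center (SpecialLinearGroup (Fin 2) F)), natCard_center h2]
    push_cast
    ring
  · rintro _ ⟨t, ht, rfl⟩ ha x hx
    obtain ⟨x, rfl⟩ := proj_surjective x
    rw [← map_mul, ← map_inv, ← map_mul, proj_mem_map_iff (center_le_torus d)] at hx
    exact hd (isSquare_of_conj h2 ht (proj_ne_one ht ha) hx)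

end Main

end SLTwo

/-- Savitskii's criterion for `PSL₂(𝔽_q)`, `q ≥ 5` odd:
`ℂ[PSL₂(𝔽_q)]` is of Knutson type iff `q = 2^m + 1` or `q = 2^m − 1` for some `m ≥ 1`. -/
theorem psl2_isKnutsonType_iff (q : ℕ) (hq : IsPrimePow q) (hodd : Odd q) (h5 : 5 ≤ q)
    (F : Type) [Field F] [Fintype F] (hF : Fintype.card F = q) :
    IsKnutsonType
        (Matrix.SpecialLinearGroup (Fin 2) F ⧸
          Subgroup.center (Matrix.SpecialLinearGroup (Fin 2) F)) ↔
      ∃ m : ℕ, 0 < m ∧ (q = 2 ^ m + 1 ∨ q = 2 ^ m - 1) := by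
  have := Fintype.ofFinite (Matrix.SpecialLinearGroup (Fin 2) F ⧸
    Subgroup.center (Matrix.SpecialLinearGroup (Fin 2) F))
  subst hF
  obtain ⟨d, hd⟩ := SLTwo.exists_not_isSquare hodd
  have h := SLTwo.isPSLTwoLike hodd hd
  have hA := h.card_left
  have hC := h.card_right
  rcases Nat.odd_mod_four_iff.mp (Nat.odd_iff.mp hodd) with h4 | h4
  · have hCo : Odd (Nat.card ((SLTwo.torus d).map (SLTwo.proj F))) := by
      rw [Nat.odd_iff]
      omega
    constructor
    · intro hK
      obtain ⟨k, hk⟩ := h.exists_card_eq_two_pow hCo hK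
      exact ⟨k + 1, k.succ_pos, Or.inl (by rw [pow_succ]; omega)⟩
    · rintro ⟨_ | _ | k, hm, hq⟩
      · exact absurd hm (lt_irrefl _)
      · omega
      · refine h.isKnutsonType hCo (k := k + 1) ?_
        simp only [pow_succ] at hq ⊢
        omega
  · have hAo : Odd (Nat.card ((SLTwo.torus (1 : F)).map (SLTwo.proj F))) := by
      rw [Nat.odd_iff]
      omega
    constructor
    · intro hK
      obtain ⟨k, hk⟩ := h.symm.exists_card_eq_two_pow hAo hK
      exact ⟨k + 1, k.succ_pos, Or.inr (by rw [pow_succ]; omega)⟩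
    · rintro ⟨_ | _ | k, hm, hq⟩
      · exact absurd hm (lt_irrefl _)
      · omega
      · refine h.symm.isKnutsonType hAo (k := k + 1) ?_
        simp only [pow_succ] at hq ⊢
        omega
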